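/- Let G be a minimal non-weakly flat path extendable graph with no even hole and no sector wheel. Then G has no star cutset. -/

import Mathlib

open Classical

universe u

/-- `IsHoleOn G n H`: `H` is the vertex set of an induced cycle of `G` of length `n ≥ 4`. -/
def IsHoleOn {V : Type u} (G : SimpleGraph V) (n : ℕ) (H : Set V) : Prop :=
  4 ≤ n ∧ ∃ f : ZMod n → V, Function.Injective f ∧ Set.range f = H ∧
    ∀ i j : ZMod n, G.Adj (f i) (f j) ↔ (j = i + 1 ∨ i = j + 1)

/-- A hole: an induced cycle of length at least 4. -/
def IsHole {V : Type u} (G : SimpleGraph V) (H : Set V) : Prop :=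
  ∃ n : ℕ, IsHoleOn G n H

/-- No induced cycle of even length. -/
def EvenHoleFree {V : Type u} (G : SimpleGraph V) : Prop :=
  ∀ (n : ℕ) (H : Set V), IsHoleOn G n H → ¬ Even n

/-- `G[X]` is chordal: no hole of `G` is contained in `X`. -/
def ChordalSet {V : Type u} (G : SimpleGraph V) (X : Set V) : Prop :=
  ∀ H : Set V, H ⊆ X → ¬ IsHole G H

/-- A wheel `(H, w)`: a hole `H` and `w ∉ H` with at least 3 neighbors in `H`. -/
def IsWheel {V : Type u} (G : SimpleGraph V) (H : Set V) (w : V) : Prop :=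
  IsHole G H ∧ w ∉ H ∧ 3 ≤ (H ∩ {u | G.Adj w u}).ncard

/-- An induced path of `G`, recorded as the list of its vertices in order. -/
def IsInducedPathList {V : Type u} (G : SimpleGraph V) (l : List V) : Prop :=
  l ≠ [] ∧ l.Nodup ∧
    ∀ (i j : ℕ) (hi : i < l.length) (hj : j < l.length),
      G.Adj (l.get ⟨i, hi⟩) (l.get ⟨j, hj⟩) ↔ (i + 1 = j ∨ j + 1 = i)

/-- A vertex set that induces a path. -/
def InducesPath {V : Type u} (G : SimpleGraph V) (S : Set V) : Prop :=
  ∃ l : List V, IsInducedPathList G l ∧ {v | v ∈ l} = S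

/-- A sector wheel: a wheel `(H, w)` where `w` is complete to `H` or
`N(w) ∩ H` induces a path. -/
def IsSectorWheel {V : Type u} (G : SimpleGraph V) (H : Set V) (w : V) : Prop :=
  IsWheel G H w ∧
    ((∀ u ∈ H, G.Adj w u) ∨ InducesPath G (H ∩ {u | G.Adj w u}))

/-- A twin wheel: a wheel `(H, w)` where `N(w) ∩ H` induces a three-vertex path. -/
def IsTwinWheel {V : Type u} (G : SimpleGraph V) (H : Set V) (w : V) : Prop :=
  IsWheel G H w ∧ ∃ a b c : V, a ≠ b ∧ b ≠ c ∧ a ≠ c ∧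
    H ∩ {u | G.Adj w u} = {a, b, c} ∧ G.Adj a b ∧ G.Adj b c ∧ ¬ G.Adj a c

/-- A short pyramid: a wheel `(H, w)` where `N(w) ∩ H` is an edge plus an isolated vertex. -/
def IsShortPyramid {V : Type u} (G : SimpleGraph V) (H : Set V) (w : V) : Prop :=
  IsWheel G H w ∧ ∃ a b c : V, a ≠ b ∧ b ≠ c ∧ a ≠ c ∧
    H ∩ {u | G.Adj w u} = {a, b, c} ∧ G.Adj a b ∧ ¬ G.Adj a c ∧ ¬ G.Adj b c

/-- A flat path: an induced path all of whose interior vertices have degree 2 in `G`. -/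
def IsFlatPath {V : Type u} (G : SimpleGraph V) (l : List V) : Prop :=
  IsInducedPathList G l ∧
    ∀ (i : ℕ) (hi : i < l.length), 0 < i → i + 1 < l.length →
      ({u | G.Adj (l.get ⟨i, hi⟩) u}).ncard = 2

/-- The closed neighborhood `N[S]` of a set of vertices. -/
def ClosedNbhd {V : Type u} (G : SimpleGraph V) (S : Set V) : Set V :=
  S ∪ {v | ∃ s ∈ S, G.Adj v s}

/-- `(W1, W2)` (a precover on a path with vertex set `S`) extends to a chordal cover of `G`. -/
def ExtendsToCover {V : Type u} (G : SimpleGraph V) (S W1 W2 : Set V) : Prop :=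
  ∃ X1 X2 : Set V, W1 ⊆ X1 ∧ W2 ⊆ X2 ∧ ChordalSet G X1 ∧ ChordalSet G X2 ∧
    X1 ∩ X2 = S ∧ X1 ∪ X2 = Set.univ

/-- Flat path extendable. -/
def FPE {V : Type u} (G : SimpleGraph V) : Prop :=
  ∀ l : List V, IsFlatPath G l →
    ∀ W1 W2 : Set V, ChordalSet G W1 → ChordalSet G W2 →
      W1 ∩ W2 = {v | v ∈ l} → W1 ∪ W2 = ClosedNbhd G {v | v ∈ l} →
      ExtendsToCover G {v | v ∈ l} W1 W2

/-- Weakly flat path extendable: only paths with at most two vertices are considered. -/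
def WeaklyFPE {V : Type u} (G : SimpleGraph V) : Prop :=
  ∀ l : List V, IsInducedPathList G l → l.length ≤ 2 →
    ∀ W1 W2 : Set V, ChordalSet G W1 → ChordalSet G W2 →
      W1 ∩ W2 = {v | v ∈ l} → W1 ∪ W2 = ClosedNbhd G {v | v ∈ l} →
      ExtendsToCover G {v | v ∈ l} W1 W2

/-- Minimal non flat path extendable. -/
def MNFPE {V : Type u} (G : SimpleGraph V) : Prop :=
  ¬ FPE G ∧ ∀ S : Set V, S ≠ Set.univ → FPE (G.induce S)

/-- Minimal non-weakly flat path extendable. -/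
def MinNonWeaklyFPE {V : Type u} (G : SimpleGraph V) : Prop :=
  ¬ WeaklyFPE G ∧ ∀ S : Set V, S ≠ Set.univ → WeaklyFPE (G.induce S)

/-- A witness path `l` with witness sets `W1, W2`: a precover on a flat path
admitting no extension to a chordal cover. -/
def WitnessPath {V : Type u} (G : SimpleGraph V) (l : List V) (W1 W2 : Set V) : Prop :=
  IsFlatPath G l ∧ ChordalSet G W1 ∧ ChordalSet G W2 ∧
    W1 ∩ W2 = {v | v ∈ l} ∧ W1 ∪ W2 = ClosedNbhd G {v | v ∈ l} ∧
    ¬ ExtendsToCover G {v | v ∈ l} W1 W2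

/-- A witness path of length zero or one with witness sets, for the weak notion. -/
def WeakWitness {V : Type u} (G : SimpleGraph V) (l : List V) (W1 W2 : Set V) : Prop :=
  IsInducedPathList G l ∧ l.length ≤ 2 ∧ ChordalSet G W1 ∧ ChordalSet G W2 ∧
    W1 ∩ W2 = {v | v ∈ l} ∧ W1 ∪ W2 = ClosedNbhd G {v | v ∈ l} ∧
    ¬ ExtendsToCover G {v | v ∈ l} W1 W2

/-- `N(v)` is the union of a clique and a singleton. -/
def NearlySimplicial {V : Type u} (G : SimpleGraph V) (v : V) : Prop :=
  ∃ (K : Set V) (u : V), G.IsClique K ∧ {w | G.Adj v w} = K ∪ {u}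

/-- `G` has a star cutset. -/
def HasStarCutset {V : Type u} (G : SimpleGraph V) : Prop :=
  G.Connected ∧ ∃ (v : V) (C : Set V), v ∈ C ∧ C ⊆ insert v {u | G.Adj v u} ∧
    ¬ (G.induce (Cᶜ : Set V)).Connected

/-- `v` is the center of a star cutset of `G`. -/
def IsStarCutsetCenter {V : Type u} (G : SimpleGraph V) (v : V) : Prop :=
  G.Connected ∧ ∃ C : Set V, v ∈ C ∧ C ⊆ insert v {u | G.Adj v u} ∧
    ¬ (G.induce (Cᶜ : Set V)).Connected

/-- `G` has a full star cutset, i.e. a star cutset of the form `N[v]`. -/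
def HasFullStarCutset {V : Type u} (G : SimpleGraph V) : Prop :=
  G.Connected ∧ ∃ v : V,
    ¬ (G.induce (((insert v {u | G.Adj v u}) : Set V)ᶜ)).Connected

/-- A clique cutset. -/
def IsCliqueCutset {V : Type u} (G : SimpleGraph V) (Q : Set V) : Prop :=
  G.IsClique Q ∧ ¬ (G.induce (Qᶜ : Set V)).Connected

/-- `C` is (the vertex set of) a connected component of `G[S]`. -/
def IsCompOf {V : Type u} (G : SimpleGraph V) (S C : Set V) : Prop :=
  ∃ comp : (G.induce S).ConnectedComponent, C = Subtype.val '' comp.supp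

/-- A marker path for the side `(A, C, B)` of a 2-join, with ends `a ∈ A` and `b ∈ B`
and interior in `C`. -/
def IsMarkerPath {V : Type u} (G : SimpleGraph V) (A C B : Set V) (a b : V)
    (l : List V) : Prop :=
  IsInducedPathList G l ∧ a ∈ A ∧ b ∈ B ∧
    ∃ m : List V, l = a :: (m ++ [b]) ∧ ∀ v ∈ m, v ∈ C

/-- A 2-join of `G`. -/
def IsTwoJoin {V : Type u} (G : SimpleGraph V) (A1 C1 B1 A2 C2 B2 : Set V) : Prop :=
  ([A1, C1, B1, A2, C2, B2] : List (Set V)).Pairwise Disjoint ∧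
  A1 ∪ C1 ∪ B1 ∪ A2 ∪ C2 ∪ B2 = Set.univ ∧
  (∀ a ∈ A1, ∀ b ∈ A2, G.Adj a b) ∧
  (∀ a ∈ B1, ∀ b ∈ B2, G.Adj a b) ∧
  (∀ u ∈ A1 ∪ C1 ∪ B1, ∀ v ∈ A2 ∪ C2 ∪ B2, G.Adj u v →
    ((u ∈ A1 ∧ v ∈ A2) ∨ (u ∈ B1 ∧ v ∈ B2))) ∧
  (∃ (a b : V) (l : List V), IsMarkerPath G A1 C1 B1 a b l ∧
      A1 ∪ C1 ∪ B1 ≠ {v | v ∈ l}) ∧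
  (∃ (a b : V) (l : List V), IsMarkerPath G A2 C2 B2 a b l ∧
      A2 ∪ C2 ∪ B2 ≠ {v | v ∈ l})

/-- A leaf of a graph: a vertex of degree one. -/
def IsLeaf {V : Type u} (T : SimpleGraph V) (v : V) : Prop :=
  ({u | T.Adj v u}).ncard = 1

/-- The graph `B(T)` built from a tree `T` whose bipartition is given by the proper
2-coloring `c`: vertices are the edges of `T` plus two extra vertices `x_false, x_true`
(encoded as `Bool`); two edges are adjacent iff they share an endpoint, `x_i` is adjacent
to the pendant edge at each leaf on side `i`, and `x_false` is adjacent to `x_true`. -/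
def BGraph {V : Type u} (T : SimpleGraph V) (c : V → Bool) :
    SimpleGraph (↥T.edgeSet ⊕ Bool) :=
  SimpleGraph.fromRel fun a b =>
    match a, b with
    | Sum.inl e, Sum.inl f => ∃ v : V, v ∈ e.val ∧ v ∈ f.val
    | Sum.inl e, Sum.inr i => ∃ v : V, IsLeaf T v ∧ c v = i ∧ v ∈ e.val
    | Sum.inr _, Sum.inl _ => False
    | Sum.inr _, Sum.inr _ => True

/-- `f 0, …, f m` are the vertices, in order, of an induced path. -/
def IsInducedPathFn {V : Type u} (G : SimpleGraph V) (f : ℕ → V) (m : ℕ) : Prop :=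
  ∀ i j, i ≤ m → j ≤ m →
    (f i = f j → i = j) ∧ (G.Adj (f i) (f j) ↔ (i + 1 = j ∨ j + 1 = i))

/-- `b` can be reached from `a` by a walk all of whose vertices after `a` lie in `S`. -/
def ReachIn {V : Type u} (G : SimpleGraph V) (S : Set V) (a b : V) : Prop :=
  Relation.ReflTransGen (fun u w => G.Adj u w ∧ w ∈ S) a b

/-- `a` and `b` are joined by a walk with nonempty interior contained in `S`. -/
def JoinedVia {V : Type u} (G : SimpleGraph V) (S : Set V) (a b : V) : Prop :=
  ∃ s t, s ∈ S ∧ t ∈ S ∧ G.Adj a s ∧ ReachIn G S s t ∧ G.Adj t b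

section Reach

variable {V : Type u} {G : SimpleGraph V} {S T : Set V} {a b c : V}

theorem ReachIn.mono (hST : S ⊆ T) (h : ReachIn G S a b) : ReachIn G T a b :=
  Relation.ReflTransGen.mono (fun _ _ hw => ⟨hw.1, hST hw.2⟩) _ _ h

theorem ReachIn.mem (ha : a ∈ S) (h : ReachIn G S a b) : b ∈ S := by
  induction h with
  | refl => exact ha
  | tail _ h _ => exact h.2

theorem ReachIn.tail (h : ReachIn G S a b) (hbc : G.Adj b c) (hc : c ∈ S) :
    ReachIn G S a c :=
  Relation.ReflTransGen.tail h ⟨hbc, hc⟩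

theorem ReachIn.symm (ha : a ∈ S) (h : ReachIn G S a b) : ReachIn G S b a := by
  induction h with
  | refl => exact Relation.ReflTransGen.refl
  | tail h' h ih =>
    exact Relation.ReflTransGen.head ⟨h.1.symm, ReachIn.mem ha h'⟩ ih

theorem ReachIn.restrict_class {d : V} (h : ReachIn G S a b) (ha : ReachIn G S d a) :
    ReachIn G {w | ReachIn G S d w} a b := by
  induction h with
  | refl => exact Relation.ReflTransGen.refl
  | tail h' h ih => exact ih.tail h.1 ((Relation.ReflTransGen.trans ha h').tail h)

theorem JoinedVia.mono (hST : S ⊆ T) (h : JoinedVia G S a b) : JoinedVia G T a b := by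
  obtain ⟨s, t, hs, ht, h1, h2, h3⟩ := h
  exact ⟨s, t, hST hs, hST ht, h1, h2.mono hST, h3⟩

theorem connected_of_reachIn (hne : S.Nonempty)
    (h : ∀ d ∈ S, ∀ e ∈ S, ReachIn G S d e) : (G.induce S).Connected := by
  have key : ∀ d e, ReachIn G S d e → ∀ (hd : d ∈ S) (he : e ∈ S),
      (G.induce S).Reachable ⟨d, hd⟩ ⟨e, he⟩ := by
    intro d e hde hd
    induction hde with
    | refl => intro _; exact SimpleGraph.Reachable.refl _
    | tail h' h ih =>
      intro he
      have hb := ReachIn.mem hd h'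
      refine (ih hb).trans (SimpleGraph.Adj.reachable ?_)
      simpa using h.1
  obtain ⟨d, hd⟩ := hne
  have : Nonempty S := ⟨⟨d, hd⟩⟩
  exact ⟨fun x y => key _ _ (h _ x.2 _ y.2) x.2 y.2⟩

theorem ReachIn.exists_seq (h : ReachIn G S a b) :
    ∃ (n : ℕ) (f : ℕ → V), f 0 = a ∧ f n = b ∧ (∀ i < n, G.Adj (f i) (f (i + 1))) ∧
      ∀ i, 0 < i → i ≤ n → f i ∈ S := by
  induction h with
  | refl => exact ⟨0, fun _ => a, rfl, rfl, by omega, by omega⟩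
  | @tail b c _ h ih =>
    obtain ⟨n, f, h0, hn, hadj, hS⟩ := ih
    refine ⟨n + 1, fun i => if i ≤ n then f i else c, by simp [h0], by simp, ?_, ?_⟩
    · intro i hi
      by_cases hin : i = n
      · subst hin
        simpa [hn] using h.1
      · have h1 : i ≤ n := by omega
        have h2 : i + 1 ≤ n := by omega
        simpa [h1, h2] using hadj i (by omega)
    · intro i h0 hi
      by_cases hin : i ≤ n
      · simpa [hin] using hS i h0 hin
      · simpa [hin] using h.2

/-- A shortest walk from `a` to `b` through `S` is an induced path. -/
theorem JoinedVia.exists_inducedPathFn (h : JoinedVia G S a b) (hab : a ≠ b)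
    (hnadj : ¬ G.Adj a b) :
    ∃ (m : ℕ) (f : ℕ → V), 2 ≤ m ∧ f 0 = a ∧ f m = b ∧ IsInducedPathFn G f m ∧
      ∀ i, 0 < i → i < m → f i ∈ S := by
  have hex : ∃ m : ℕ, ∃ f : ℕ → V, f 0 = a ∧ f m = b ∧
      (∀ i < m, G.Adj (f i) (f (i + 1))) ∧ ∀ i, 0 < i → i < m → f i ∈ S := by
    obtain ⟨s, t, hs, ht, h1, h2, h3⟩ := h
    have h4 : ReachIn G S a t := Relation.ReflTransGen.head ⟨h1, hs⟩ h2
    obtain ⟨n, f, h0, hn, hadj, hS⟩ := h4.exists_seq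
    refine ⟨n + 1, fun i => if i ≤ n then f i else b, by simp [h0], by simp, ?_, ?_⟩
    · intro i hi
      by_cases hin : i = n
      · subst hin
        simpa [hn] using h3
      · have h1 : i ≤ n := by omega
        have h2 : i + 1 ≤ n := by omega
        simpa [h1, h2] using hadj i (by omega)
    · intro i h0 hi
      have hin : i ≤ n := by omega
      simpa [hin] using hS i h0 hin
  obtain ⟨f, h0, hm, hadj, hS⟩ := Nat.find_spec hex
  have hmin : ∀ k, k < Nat.find hex → ¬ _ := fun k hk => Nat.find_min hex hk
  generalize Nat.find hex = m at *
  have hne : ∀ i j, i < j → j ≤ m → f i ≠ f j := by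
    intro i j hij hj he
    refine hmin (m - (j - i)) (by omega)
      ⟨fun k => if k ≤ i then f k else f (k + (j - i)), by simp [h0], ?_, ?_, ?_⟩
    · by_cases hjm : j = m
      · have : m - (j - i) = i := by omega
        beta_reduce
        rw [this, if_pos le_rfl, he, hjm, hm]
      · have h1 : ¬ (m - (j - i) ≤ i) := by omega
        have h2 : m - (j - i) + (j - i) = m := by omega
        simp [h1, h2, hm]
    · intro k hk
      by_cases h1 : k + 1 ≤ i
      · have h2 : k ≤ i := by omega
        simpa [h1, h2] using hadj k (by omega)
      · by_cases h2 : k = i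
        · subst h2
          have h3 : k + 1 + (j - k) = j + 1 := by omega
          simpa [h3, he] using hadj j (by omega)
        · have h3 : ¬ k ≤ i := by omega
          have h4 : k + 1 + (j - i) = k + (j - i) + 1 := by omega
          simpa [h1, h3, h4] using hadj (k + (j - i)) (by omega)
    · intro k hk0 hk
      by_cases h1 : k ≤ i
      · simpa [h1] using hS k hk0 (by omega)
      · simpa [h1] using hS (k + (j - i)) (by omega) (by omega)
  have hna : ∀ i j, i + 1 < j → j ≤ m → ¬ G.Adj (f i) (f j) := by
    intro i j hij hj he
    refine hmin (m - (j - i - 1)) (by omega)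
      ⟨fun k => if k ≤ i then f k else f (k + (j - i - 1)), by simp [h0], ?_, ?_, ?_⟩
    · have h1 : ¬ (m - (j - i - 1) ≤ i) := by omega
      have h2 : m - (j - i - 1) + (j - i - 1) = m := by omega
      simp [h1, h2, hm]
    · intro k hk
      by_cases h1 : k + 1 ≤ i
      · have h2 : k ≤ i := by omega
        simpa [h1, h2] using hadj k (by omega)
      · by_cases h2 : k = i
        · subst h2
          have h3 : k + 1 + (j - k - 1) = j := by omega
          simpa [h3] using he
        · have h3 : ¬ k ≤ i := by omega
          have h4 : k + 1 + (j - i - 1) = k + (j - i - 1) + 1 := by omega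
          simpa [h1, h3, h4] using hadj (k + (j - i - 1)) (by omega)
    · intro k hk0 hk
      by_cases h1 : k ≤ i
      · simpa [h1] using hS k hk0 (by omega)
      · simpa [h1] using hS (k + (j - i - 1)) (by omega) (by omega)
  refine ⟨m, f, ?_, h0, hm, ?_, hS⟩
  · by_contra hlt
    have : m = 0 ∨ m = 1 := by omega
    rcases this with rfl | rfl
    · exact hab (h0.symm.trans hm)
    · exact hnadj (by simpa [h0, hm] using hadj 0 (by omega))
  · intro i j hi hj
    refine ⟨fun he => ?_, fun he => ?_, ?_⟩
    · by_contra hc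
      rcases Nat.lt_or_gt_of_ne hc with hlt | hlt
      · exact hne i j hlt hj he
      · exact hne j i hlt hi he.symm
    · by_contra hc
      have hij : i ≠ j := fun h => G.loopless.irrefl (f i) (by simp [h] at he)
      rcases Nat.lt_or_gt_of_ne hij with hlt | hlt
      · exact hna i j (by omega) hj he
      · exact hna j i (by omega) hi he.symm
    · rintro (rfl | rfl)
      · exact hadj i (by omega)
      · exact (hadj j (by omega)).symm

end Reach

section Holes

variable {V : Type u} {G : SimpleGraph V}

theorem isHoleOn_of_cyclic_seq (h : ℕ → V) (n : ℕ) (hn : 4 ≤ n)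
    (hinj : ∀ i j, i < j → j < n → h i ≠ h j)
    (hadj : ∀ i j, i < j → j < n → (G.Adj (h i) (h j) ↔ (i + 1 = j ∨ (i = 0 ∧ j + 1 = n)))) :
    IsHoleOn G n {w | ∃ i < n, h i = w} := by
  have : NeZero n := ⟨by omega⟩
  have : Fact (1 < n) := ⟨by omega⟩
  have hval : ∀ i j : ZMod n, j = i + 1 ↔ (j.val = i.val + 1 ∨ (i.val + 1 = n ∧ j.val = 0)) := by
    intro i j
    rw [← (ZMod.val_injective n).eq_iff, ZMod.val_add, ZMod.val_one]
    have hi := ZMod.val_lt i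
    have hj := ZMod.val_lt j
    by_cases hc : i.val + 1 = n
    · rw [hc, Nat.mod_self]; omega
    · rw [Nat.mod_eq_of_lt (by omega)]; omega
  refine ⟨hn, fun z => h z.val, ?_, ?_, ?_⟩
  · intro i j hij
    apply ZMod.val_injective n
    by_contra hc
    rcases Nat.lt_or_gt_of_ne hc with hlt | hlt
    · exact hinj _ _ hlt (ZMod.val_lt j) hij
    · exact hinj _ _ hlt (ZMod.val_lt i) hij.symm
  · ext w
    constructor
    · rintro ⟨z, rfl⟩
      exact ⟨z.val, ZMod.val_lt z, rfl⟩
    · rintro ⟨i, hi, rfl⟩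
      exact ⟨(i : ZMod n), by simp [ZMod.val_natCast, Nat.mod_eq_of_lt hi]⟩
  · intro i j
    rw [hval i j, hval j i]
    have hi := ZMod.val_lt i
    have hj := ZMod.val_lt j
    rcases lt_trichotomy i.val j.val with hlt | heq | hlt
    · rw [hadj _ _ hlt hj]; omega
    · simp only [heq, SimpleGraph.irrefl, false_iff]; omega
    · rw [G.adj_comm, hadj _ _ hlt hi]; omega

theorem IsHole.exists_cyclic_seq {H : Set V} (hH : IsHole G H) {z : V} (hz : z ∈ H) :
    ∃ (n : ℕ) (h : ℕ → V), 4 ≤ n ∧ h 0 = z ∧ (∀ w ∈ H, ∃ i < n, h i = w) ∧ (∀ i, h i ∈ H) ∧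
      (∀ i j, h i = h j ↔ i % n = j % n) ∧
      (∀ i j, G.Adj (h i) (h j) ↔ ((i + 1) % n = j % n ∨ (j + 1) % n = i % n)) := by
  obtain ⟨n, hn, f, hinj, hran, hadj⟩ := hH
  have : NeZero n := ⟨by omega⟩
  rw [← hran] at hz
  obtain ⟨c, rfl⟩ := hz
  refine ⟨n, fun i => f (c + (i : ZMod n)), hn, by simp, ?_, ?_, ?_, ?_⟩
  · intro w hw
    rw [← hran] at hw
    obtain ⟨k, rfl⟩ := hw
    refine ⟨(k - c).val, ZMod.val_lt _, ?_⟩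
    simp
  · intro i
    rw [← hran]
    exact ⟨_, rfl⟩
  · intro i j
    rw [hinj.eq_iff, add_right_inj, ZMod.natCast_eq_natCast_iff']
  · intro i j
    have h1 : ∀ i j : ℕ, (c + (j : ZMod n) = c + (i : ZMod n) + 1) ↔ (i + 1) % n = j % n := by
      intro i j
      rw [add_assoc, add_right_inj, ← ZMod.natCast_eq_natCast_iff']
      push_cast
      exact eq_comm
    rw [hadj, h1, h1]

/-- Two induced paths with common ends and otherwise disjoint and anticomplete form a hole. -/
theorem IsInducedPathFn.isHoleOn {f g : ℕ → V} {m k : ℕ} (hf : IsInducedPathFn G f m)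
    (hg : IsInducedPathFn G g k) (hm : 2 ≤ m) (hk : 2 ≤ k) (h0 : f 0 = g 0) (h1 : f m = g k)
    (hd : ∀ i j, 0 < i → i < m → 0 < j → j < k → f i ≠ g j ∧ ¬ G.Adj (f i) (g j)) :
    IsHoleOn G (m + k) {w | (∃ i ≤ m, f i = w) ∨ ∃ j, 0 < j ∧ j < k ∧ g j = w} := by
  have key := isHoleOn_of_cyclic_seq (G := G)
    (fun i => if i ≤ m then f i else g (m + k - i)) (m + k) (by omega) ?_ ?_
  · convert key using 1
    ext w
    constructor
    · rintro (⟨i, hi, rfl⟩ | ⟨j, hj0, hj, rfl⟩)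
      · exact ⟨i, by omega, by simp [hi]⟩
      · refine ⟨m + k - j, by omega, ?_⟩
        have h2 : ¬ (m + k - j ≤ m) := by omega
        have h3 : m + k - (m + k - j) = j := by omega
        simp [h2, h3]
    · rintro ⟨i, hi, rfl⟩
      by_cases him : i ≤ m
      · left; exact ⟨i, him, by simp [him]⟩
      · right; exact ⟨m + k - i, by omega, by omega, by simp [him]⟩
  · intro i j hij hj he
    by_cases hjm : j ≤ m
    · have him : i ≤ m := by omega
      simp only [him, hjm, if_true] at he
      have := (hf i j him hjm).1 he
      omega
    · by_cases him : i ≤ m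
      · simp only [him, hjm, if_true, if_false] at he
        by_cases hi0 : i = 0
        · rw [hi0, h0] at he
          have := (hg 0 (m + k - j) (by omega) (by omega)).1 he
          omega
        · by_cases hi1 : i = m
          · rw [hi1, h1] at he
            have := (hg k (m + k - j) (by omega) (by omega)).1 he
            omega
          · exact (hd i (m + k - j) (by omega) (by omega) (by omega) (by omega)).1 he
      · simp only [him, hjm, if_false] at he
        have := (hg (m + k - i) (m + k - j) (by omega) (by omega)).1 he
        omega
  · intro i j hij hj
    by_cases hjm : j ≤ m
    · have him : i ≤ m := by omega
      simp only [him, hjm, if_true]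
      rw [(hf i j him hjm).2]
      omega
    · by_cases him : i ≤ m
      · simp only [him, hjm, if_true, if_false]
        by_cases hi0 : i = 0
        · rw [hi0, h0, (hg 0 (m + k - j) (by omega) (by omega)).2]
          omega
        · by_cases hi1 : i = m
          · rw [hi1, h1, (hg k (m + k - j) (by omega) (by omega)).2]
            omega
          · have := (hd i (m + k - j) (by omega) (by omega) (by omega) (by omega)).2
            simp only [this, false_iff]
            omega
      · simp only [him, hjm, if_false]
        rw [(hg (m + k - i) (m + k - j) (by omega) (by omega)).2]
        omega

theorem isInducedPathFn_two {a u b : V} (hau : G.Adj a u) (hub : G.Adj u b) (hab : a ≠ b)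
    (hnab : ¬ G.Adj a b) :
    IsInducedPathFn G (fun i => if i = 0 then a else if i = 1 then u else b) 2 := by
  have h1 := hau.ne
  have h2 := hub.ne
  have h3 : ¬ G.Adj b a := fun h => hnab h.symm
  intro i j hi hj
  interval_cases i <;> interval_cases j <;>
    simp [hau, hub, hab, hnab, h1, h2, h3, h1.symm, h2.symm, hab.symm, hau.symm, hub.symm]

/-- Adding a vertex adjacent only to the first vertex extends an induced path. -/
theorem IsInducedPathFn.cons {f : ℕ → V} {m : ℕ} (hf : IsInducedPathFn G f m) {x : V}
    (hx : G.Adj x (f 0)) (hn : ∀ i, 0 < i → i ≤ m → x ≠ f i ∧ ¬ G.Adj x (f i)) :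
    IsInducedPathFn G (fun i => if i = 0 then x else f (i - 1)) (m + 1) := by
  have hxi : ∀ i, 0 < i → i ≤ m + 1 → x ≠ f (i - 1) ∧ (G.Adj x (f (i - 1)) ↔ i = 1) := by
    intro i h0 hi
    by_cases h1 : i = 1
    · subst h1
      exact ⟨hx.ne, by simpa using hx⟩
    · have := hn (i - 1) (by omega) (by omega)
      exact ⟨this.1, by simp [this.2, h1]⟩
  intro i j hi hj
  by_cases hi0 : i = 0 <;> by_cases hj0 : j = 0
  · subst hi0 hj0; simp
  · subst hi0
    have := hxi j (by omega) hj
    simp only [if_true, hj0, if_false]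
    exact ⟨fun h => absurd h this.1, this.2.trans (by omega)⟩
  · subst hj0
    have := hxi i (by omega) hi
    simp only [if_true, hi0, if_false]
    exact ⟨fun h => absurd h.symm this.1, by rw [G.adj_comm]; exact this.2.trans (by omega)⟩
  · simp only [hi0, hj0, if_false]
    have := hf (i - 1) (j - 1) (by omega) (by omega)
    exact ⟨fun h => by have := this.1 h; omega, this.2.trans (by omega)⟩

theorem exists_isHole_of_joinedVia {S : Set V} {u a b : V} (hua : G.Adj u a) (hub : G.Adj u b)
    (hab : a ≠ b) (hnab : ¬ G.Adj a b) (hS : ∀ s ∈ S, s ≠ u ∧ ¬ G.Adj u s)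
    (hj : JoinedVia G S a b) :
    ∃ H, IsHole G H ∧ ∀ w ∈ H, w = u ∨ w = a ∨ w = b ∨ w ∈ S := by
  obtain ⟨m, f, hm, h0, h1, hf, hfS⟩ := hj.exists_inducedPathFn hab hnab
  have hg := isInducedPathFn_two hua.symm hub hab hnab
  refine ⟨_, ⟨_, hf.isHoleOn hg hm le_rfl (by simpa using h0) (by simpa using h1) ?_⟩, ?_⟩
  · intro i j hi0 hi hj0 hj2
    have hj1 : j = 1 := by omega
    subst hj1
    have := hS _ (hfS i hi0 hi)
    simpa [G.adj_comm] using this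
  · rintro w (⟨i, hi, rfl⟩ | ⟨j, hj0, hj2, rfl⟩)
    · by_cases hi0 : i = 0
      · subst hi0; simp [h0]
      · by_cases him : i = m
        · subst him; simp [h1]
        · exact Or.inr (Or.inr (Or.inr (hfS i (by omega) (by omega))))
    · have hj1 : j = 1 := by omega
      subst hj1
      simp

/-- If a hole meets `D` and has a vertex far from `D`, some segment of it inside `D` joins
two distinct nonadjacent vertices outside `D`. -/
theorem IsHole.exists_segment {H D : Set V} (hH : IsHole G H) {z d : V} (hz : z ∈ H)
    (hzD : z ∉ D) (hzn : ∀ w ∈ H, w ∈ D → ¬ G.Adj z w) (hd : d ∈ H) (hdD : d ∈ D) :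
    ∃ a b, a ∈ H ∧ a ∉ D ∧ b ∈ H ∧ b ∉ D ∧ a ≠ b ∧ ¬ G.Adj a b ∧
      JoinedVia G (H ∩ D) a b := by
  obtain ⟨n, h, hn, h0, hsurj, hmem, hinj, hadj⟩ := hH.exists_cyclic_seq hz
  have hex : ∃ i, h i ∈ D := by
    obtain ⟨i, _, rfl⟩ := hsurj d hd
    exact ⟨i, hdD⟩
  have hin : Nat.find hex < n := by
    obtain ⟨i, hi, rfl⟩ := hsurj d hd
    exact lt_of_le_of_lt (Nat.find_min' hex hdD) hi
  have hiD := Nat.find_spec hex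
  have himin : ∀ k, k < Nat.find hex → h k ∉ D := fun k hk => Nat.find_min hex hk
  generalize Nat.find hex = i at *
  have hi0 : i ≠ 0 := by rintro rfl; exact hzD (h0 ▸ hiD)
  have hnz : h n = z := by rw [← h0, hinj]; simp
  have hex2 : ∃ j, i ≤ j ∧ h j ∉ D := ⟨n, hin.le, hnz ▸ hzD⟩
  have hjn : Nat.find hex2 ≤ n := Nat.find_min' hex2 ⟨hin.le, hnz ▸ hzD⟩
  obtain ⟨hij, hjD⟩ := Nat.find_spec hex2
  have hjmin : ∀ k, i ≤ k → k < Nat.find hex2 → h k ∈ D := by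
    intro k hik hk
    by_contra hc
    exact Nat.find_min hex2 hk ⟨hik, hc⟩
  generalize Nat.find hex2 = j at *
  have hij' : i < j := by
    rcases hij.lt_or_eq with h | rfl
    · exact h
    · exact absurd hiD hjD
  have hstep : ∀ k, G.Adj (h k) (h (k + 1)) := fun k => (hadj _ _).2 (Or.inl rfl)
  have ha : i ≠ 1 := by
    rintro rfl
    exact hzn _ (hmem 1) hiD (h0 ▸ hstep 0)
  have hb : j ≠ n := by
    rintro rfl
    refine hzn _ (hmem (j - 1)) (hjmin (j - 1) (by omega) (by omega)) ?_
    have := hstep (j - 1)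
    rw [Nat.sub_add_cancel (by omega), hnz] at this
    exact this.symm
  refine ⟨h (i - 1), h j, hmem _, himin _ (by omega), hmem _, hjD, ?_, ?_,
    h i, h (j - 1), ⟨hmem _, hiD⟩, ⟨hmem _, hjmin _ (by omega) (by omega)⟩, ?_, ?_, ?_⟩
  · rw [Ne, hinj, Nat.mod_eq_of_lt (by omega), Nat.mod_eq_of_lt (by omega)]
    omega
  · rw [hadj, Nat.mod_eq_of_lt (show i - 1 < n by omega),
      Nat.mod_eq_of_lt (show i - 1 + 1 < n by omega), Nat.mod_eq_of_lt (show j < n by omega)]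
    by_cases hc : j + 1 = n
    · rw [hc, Nat.mod_self]; omega
    · rw [Nat.mod_eq_of_lt (by omega)]; omega
  · have := hstep (i - 1)
    rwa [Nat.sub_add_cancel (by omega)] at this
  · have key : ∀ k, i + k < j → ReachIn G (H ∩ D) (h i) (h (i + k)) := by
      intro k
      induction k with
      | zero => intro _; exact Relation.ReflTransGen.refl
      | succ k ih =>
        intro hk
        exact (ih (by omega)).tail (hstep _) ⟨hmem _, hjmin _ (by omega) hk⟩
    have := key (j - 1 - i) (by omega)
    rwa [show i + (j - 1 - i) = j - 1 by omega] at this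
  · have := hstep (j - 1)
    rwa [Nat.sub_add_cancel (by omega)] at this

end Holes

section Glue

variable {V : Type u} {G : SimpleGraph V}

theorem ChordalSet.mono {X Y : Set V} (hXY : X ⊆ Y) (hY : ChordalSet G Y) : ChordalSet G X :=
  fun H hH => hY H (hH.trans hXY)

theorem IsHole.image_val {S : Set V} {H : Set S} (hH : IsHole (G.induce S) H) :
    IsHole G (Subtype.val '' H) := by
  obtain ⟨n, hn, f, hinj, hran, hadj⟩ := hH
  refine ⟨n, hn, fun i => (f i).1, Subtype.val_injective.comp hinj, ?_, fun i j => ?_⟩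
  · rw [← hran, ← Set.range_comp]; rfl
  · simpa using hadj i j

theorem IsHole.preimage_val {S H : Set V} (hH : IsHole G H) (hS : H ⊆ S) :
    IsHole (G.induce S) (Subtype.val ⁻¹' H) := by
  obtain ⟨n, hn, f, hinj, hran, hadj⟩ := hH
  have hf : ∀ i, f i ∈ S := fun i => hS (hran ▸ ⟨i, rfl⟩)
  refine ⟨n, hn, fun i => ⟨f i, hf i⟩, fun i j hij => hinj (congrArg Subtype.val hij), ?_,
    fun i j => ?_⟩
  · ext ⟨w, hw⟩
    simp [← hran]
  · simpa using hadj i j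

theorem exists_pair_of_isInducedPathList {l : List V} (hl : IsInducedPathList G l)
    (h2 : l.length ≤ 2) : ∃ x y, (x = y ∨ G.Adj x y) ∧ {v | v ∈ l} = ({x, y} : Set V) := by
  obtain ⟨hne, -, hadj⟩ := hl
  match l, hne, h2, hadj with
  | [x], _, _, _ => exact ⟨x, x, Or.inl rfl, by ext; simp⟩
  | [x, y], _, _, hadj =>
    refine ⟨x, y, Or.inr ?_, by ext; simp⟩
    simpa using hadj 0 1 (by simp) (by simp)

theorem exists_isInducedPathList_of_pair {x y : V} (h : x = y ∨ G.Adj x y) :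
    ∃ l : List V, IsInducedPathList G l ∧ l.length ≤ 2 ∧ {v | v ∈ l} = ({x, y} : Set V) := by
  rcases h with rfl | h
  · refine ⟨[x], ⟨by simp, by simp, fun i j hi hj => ?_⟩, by simp, by ext; simp⟩
    simp only [List.length_singleton] at hi hj
    obtain rfl : i = 0 := by omega
    obtain rfl : j = 0 := by omega
    simp
  · refine ⟨[x, y], ⟨by simp, by simp [h.ne], fun i j hi hj => ?_⟩, by simp, by ext; simp⟩
    simp only [List.length_cons, List.length_nil] at hi hj
    have hi : i = 0 ∨ i = 1 := by omega
    have hj : j = 0 ∨ j = 1 := by omega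
    rcases hi with rfl | rfl <;> rcases hj with rfl | rfl <;> simp [h, h.symm]

/-- Extending a precover on a clique of size at most two inside an induced subgraph. -/
theorem WeaklyFPE.exists_extension {S : Set V} (hS : WeaklyFPE (G.induce S)) {p q : V}
    (hp : p ∈ S) (hq : q ∈ S) (hpq : p = q ∨ G.Adj p q) {W1 W2 : Set V}
    (h1 : ChordalSet G W1) (h2 : ChordalSet G W2) (hi : W1 ∩ W2 = {p, q})
    (hu : W1 ∪ W2 = ClosedNbhd G {p, q} ∩ S) :
    ∃ Y1 Y2 : Set V, W1 ⊆ Y1 ∧ W2 ⊆ Y2 ∧ ChordalSet G Y1 ∧ ChordalSet G Y2 ∧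
      Y1 ∩ Y2 = {p, q} ∧ Y1 ∪ Y2 = S := by
  have hpq' : (⟨p, hp⟩ : S) = ⟨q, hq⟩ ∨ (G.induce S).Adj ⟨p, hp⟩ ⟨q, hq⟩ := by
    simpa using hpq
  obtain ⟨l, hl, hl2, hlS⟩ := exists_isInducedPathList_of_pair hpq'
  have hW : ∀ W : Set V, ChordalSet G W → ChordalSet (G.induce S) (Subtype.val ⁻¹' W) :=
    fun W hW H hH hole => hW _ (Set.image_subset_iff.2 hH) hole.image_val
  have hWS1 : W1 ⊆ S := fun w hw => (hu ▸ Or.inl hw : w ∈ ClosedNbhd G {p, q} ∩ S).2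
  have hWS2 : W2 ⊆ S := fun w hw => (hu ▸ Or.inr hw : w ∈ ClosedNbhd G {p, q} ∩ S).2
  obtain ⟨X1, X2, hX1, hX2, hc1, hc2, hXi, hXu⟩ :=
    hS l hl hl2 (Subtype.val ⁻¹' W1) (Subtype.val ⁻¹' W2) (hW _ h1) (hW _ h2)
      (by rw [← Set.preimage_inter, hi, hlS]; ext ⟨w, hw⟩; simp)
      (by rw [← Set.preimage_union, hu, hlS]; ext ⟨w, hw⟩; simp [ClosedNbhd])
  have hX : ∀ X : Set S, ChordalSet (G.induce S) X → ChordalSet G (Subtype.val '' X) := by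
    intro X hX H hH hole
    refine hX (Subtype.val ⁻¹' H) ?_ (hole.preimage_val ?_)
    · rintro w hw
      obtain ⟨w', hw', he⟩ := hH hw
      rwa [← Subtype.val_injective he]
    · rintro w hw
      obtain ⟨w', -, rfl⟩ := hH hw
      exact w'.2
  refine ⟨Subtype.val '' X1, Subtype.val '' X2, ?_, ?_, hX _ hc1, hX _ hc2, ?_, ?_⟩
  · exact fun w hw => ⟨⟨w, hWS1 hw⟩, hX1 hw, rfl⟩
  · exact fun w hw => ⟨⟨w, hWS2 hw⟩, hX2 hw, rfl⟩
  · rw [← Set.image_inter Subtype.val_injective, hXi, hlS, Set.image_pair]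
  · rw [← Set.image_union, hXu, Set.image_univ, Subtype.range_coe]

/-- Gluing two chordal sets along a cutset `C` that is a clique, or is contained in the closed
neighborhood of a clique `Q` anticomplete to the side `D`. -/
theorem ChordalSet.glue {X Y C D : Set V} (hX : ChordalSet G X) (hY : ChordalSet G Y)
    (hXD : ∀ w ∈ X, w ∉ D) (hDC : ∀ d ∈ D, ∀ w, G.Adj d w → w ∈ C ∪ D)
    (hCY : ∀ a ∈ X, a ∈ C → (∃ d ∈ D, G.Adj a d) → a ∈ Y)
    (hC : G.IsClique C ∨ ∃ Q ⊆ Y, G.IsClique Q ∧ (∀ s ∈ Q, ∀ d ∈ D, s ≠ d ∧ ¬ G.Adj s d) ∧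
      C ⊆ ClosedNbhd G Q) :
    ChordalSet G (X ∪ Y ∩ D) := by
  intro H hH hole
  obtain ⟨d, hdH, hdX⟩ : ∃ d ∈ H, d ∉ X := by
    by_contra! hc
    exact hX H hc hole
  obtain ⟨z, hzH, hzY⟩ : ∃ z ∈ H, z ∉ Y := by
    by_contra! hc
    exact hY H hc hole
  have hdD : d ∈ D := ((hH hdH).resolve_left hdX).2
  have hout : ∀ a ∈ H, a ∉ D → a ∈ X := fun a ha haD =>
    (hH ha).resolve_right fun h => haD h.2
  have hnb : ∀ a ∈ H, a ∉ D → ∀ d ∈ D, G.Adj a d → a ∈ Y ∧ a ∈ C := by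
    intro a ha haD d hd had
    have haC := (hDC d hd a had.symm).resolve_right haD
    exact ⟨hCY a (hout a ha haD) haC ⟨d, hd, had⟩, haC⟩
  have hzD : z ∉ D := fun h => by
    rcases hH hzH with h' | h'
    · exact hXD z h' h
    · exact hzY h'.1
  obtain ⟨a, b, ha, haD, hb, hbD, hab, hnab, hj⟩ := hole.exists_segment hzH hzD
    (fun w _ hwD hadj => hzY (hnb z hzH hzD w hwD hadj).1) hdH hdD
  obtain ⟨s, t, hs, ht, has, hst, htb⟩ := id hj
  obtain ⟨haY, haC⟩ := hnb a ha haD s hs.2 has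
  obtain ⟨hbY, hbC⟩ := hnb b hb hbD t ht.2 htb.symm
  have hSY : H ∩ D ⊆ Y := fun w hw =>
    ((hH hw.1).resolve_left fun h => hXD w h hw.2).1
  rcases hC with hC | ⟨Q, hQY, hQ, hQD, hCQ⟩
  · exact hnab (hC haC hbC hab)
  obtain ⟨u, huQ, hau⟩ : ∃ u ∈ Q, G.Adj a u :=
    (hCQ haC).resolve_left fun h => (hQD a h s hs.2).2 has
  obtain ⟨v, hvQ, hbv⟩ : ∃ v ∈ Q, G.Adj b v :=
    (hCQ hbC).resolve_left fun h => (hQD b h t ht.2).2 htb.symm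
  have hSQ : ∀ r ∈ Q, ∀ w ∈ H ∩ D, w ≠ r ∧ ¬ G.Adj r w := fun r hr w hw =>
    ⟨(hQD r hr w hw.2).1.symm, (hQD r hr w hw.2).2⟩
  have close : ∀ r ∈ Q, G.Adj r a → G.Adj r b → False := by
    intro r hr hra hrb
    obtain ⟨H', hole', hH'⟩ := exists_isHole_of_joinedVia hra hrb hab hnab (hSQ r hr) hj
    refine hY H' (fun w hw => ?_) hole'
    rcases hH' w hw with rfl | rfl | rfl | h
    exacts [hQY hr, haY, hbY, hSY h]
  by_cases hub : G.Adj u b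
  · exact close u huQ hau.symm hub
  by_cases hva : G.Adj v a
  · exact close v hvQ hva hbv.symm
  have huv : u ≠ v := by rintro rfl; exact hub hbv.symm
  have hbu : b ≠ u := by
    rintro rfl
    exact (hQD b huQ t ht.2).2 htb.symm
  have hva' : a ≠ v := by
    rintro rfl
    exact (hQD a hvQ s hs.2).2 has
  have hj' : JoinedVia G (insert b (H ∩ D)) a v :=
    ⟨s, b, Or.inr hs, Or.inl rfl, has,
      (hst.mono (Set.subset_insert _ _)).tail htb (Or.inl rfl), hbv⟩
  obtain ⟨H', hole', hH'⟩ := exists_isHole_of_joinedVia hau.symm (hQ huQ hvQ huv) hva'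
    (fun h => hva h.symm) (S := insert b (H ∩ D)) (by
      rintro w (rfl | hw)
      · exact ⟨hbu, hub⟩
      · exact hSQ u huQ w hw) hj'
  refine hY H' (fun w hw => ?_) hole'
  rcases hH' w hw with rfl | rfl | rfl | rfl | h
  exacts [hQY huQ, haY, hQY hvQ, hbY, hSY h]

/-- A precover `(W1, W2)` on the clique `{x, y}` that does not extend to `G`, in a graph all of
whose proper induced subgraphs are weakly FPE and in which closed neighborhoods of cliques of
size at most two are chordal. -/
structure IsObstruction {V : Type u} (G : SimpleGraph V) (x y : V) (W1 W2 : Set V) : Prop where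
  sub : ∀ S : Set V, S ≠ Set.univ → WeaklyFPE (G.induce S)
  chordal : ∀ p q, (p = q ∨ G.Adj p q) → ChordalSet G (ClosedNbhd G {p, q})
  clique : x = y ∨ G.Adj x y
  inter : W1 ∩ W2 = {x, y}
  union : W1 ∪ W2 = ClosedNbhd G {x, y}
  not_extends : ¬ ExtendsToCover G {x, y} W1 W2

theorem mem_closedNbhd_pair {p q w : V} :
    w ∈ ClosedNbhd G {p, q} ↔ w = p ∨ w = q ∨ G.Adj w p ∨ G.Adj w q := by
  simp [ClosedNbhd, or_assoc]

theorem isClique_pair {p q : V} (h : p = q ∨ G.Adj p q) : G.IsClique {p, q} := by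
  rcases h with rfl | h
  · simp
  · simp [h]

/-- No cutset `C` of an obstruction lies in the closed neighborhood of a clique `{p, q}` from
which the piece `D` can be extended independently of the rest of the graph. -/
theorem IsObstruction.no_cutset {x y : V} {W1 W2 : Set V} (hO : IsObstruction G x y W1 W2)
    {p q : V} {C D : Set V} (hpq : p = q ∨ G.Adj p q) (hD : D.Nonempty)
    (hCD : ∀ d ∈ D, d ∉ C) (hDC : ∀ d ∈ D, ∀ w, G.Adj d w → w ∈ C ∪ D)
    (hrest : ∃ w, w ∉ C ∪ D) (hp : p ∈ C) (hq : q ∈ C) (hCN : C ⊆ ClosedNbhd G {p, q})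
    (hP : ∀ z ∈ ({x, y} : Set V), z ∉ D ∧ (z ∉ ({p, q} : Set V) → ∀ d ∈ D, ¬ G.Adj z d))
    (hC : G.IsClique C ∨ ∃ Q ⊆ ({p, q} : Set V), (∀ s ∈ Q, ∀ d ∈ D, ¬ G.Adj s d) ∧
      C ⊆ ClosedNbhd G Q) : False := by
  have hWc : ChordalSet G (W1 ∪ W2) := hO.union ▸ hO.chordal x y hO.clique
  have hDne : Dᶜ ≠ Set.univ := by
    obtain ⟨d, hd⟩ := hD
    exact fun h => (h ▸ Set.mem_univ d : d ∈ Dᶜ) hd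
  obtain ⟨X1, X2, hWX1, hWX2, hX1, hX2, hXi, hXu⟩ :=
    (hO.sub Dᶜ hDne).exists_extension (hP x (by simp)).1 (hP y (by simp)).1 hO.clique
      (W1 := W1 ∩ Dᶜ) (W2 := W2 ∩ Dᶜ)
      (hWc.mono fun w hw => Or.inl hw.1) (hWc.mono fun w hw => Or.inr hw.1)
      (by
        rw [← Set.inter_inter_distrib_right, hO.inter]
        exact Set.inter_eq_left.2 fun z hz => (hP z hz).1)
      (by rw [← Set.union_inter_distrib_right, hO.union])
  have hXD1 : ∀ w ∈ X1, w ∉ D := fun w hw => (hXu ▸ Or.inl hw : w ∈ Dᶜ)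
  have hXD2 : ∀ w ∈ X2, w ∉ D := fun w hw => (hXu ▸ Or.inr hw : w ∈ Dᶜ)
  have hXC : ∀ w, w ∉ D → w ∈ X1 ∨ w ∈ X2 := fun w hw => (hXu ▸ hw : w ∈ X1 ∪ X2)
  have hXP : ∀ w, w ∈ X1 → w ∈ X2 → w ∈ ({x, y} : Set V) := fun w h1 h2 => hXi ▸ ⟨h1, h2⟩
  have hWP : ∀ w, w ∈ W1 → w ∈ W2 → w ∈ ({x, y} : Set V) := fun w h1 h2 => hO.inter ▸ ⟨h1, h2⟩
  have hpD : ∀ z ∈ ({p, q} : Set V), z ∉ D := by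
    rintro z (rfl | rfl) hz
    exacts [hCD _ hz hp, hCD _ hz hq]
  have hpC : ∀ z ∈ ({p, q} : Set V), z ∈ C := by
    rintro z (rfl | rfl)
    exacts [hp, hq]
  have hNc := hO.chordal p q hpq
  have hself : ({p, q} : Set V) ⊆ ClosedNbhd G {p, q} := fun z hz => Or.inl hz
  set N := ClosedNbhd G {p, q} with hN
  obtain ⟨Y1, Y2, hWY1, hWY2, hY1, hY2, hYi, hYu⟩ :=
    (hO.sub (C ∪ D) (fun h => hrest.elim fun w hw => hw (h ▸ Set.mem_univ w))).exists_extension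
      (p := p) (q := q) (Or.inl hp) (Or.inl hq) hpq
      (W1 := {p, q} ∪ (X1 ∩ C) ∪ (D ∩ N ∩ W1))
      (W2 := {p, q} ∪ ((X2 \ X1) ∩ C) ∪ ((D ∩ N) \ W1))
      (hNc.mono (by
        rintro w ((h | h) | h)
        exacts [hself h, hCN h.2, h.1.2]))
      (hNc.mono (by
        rintro w ((h | h) | h)
        exacts [hself h, hCN h.2, h.1.2]))
      (by
        ext w
        constructor
        · rintro ⟨(h | h) | h, (h' | h') | h'⟩
          exacts [h, h, h, h', absurd h.1 h'.1.2, absurd h.2 (hCD w h'.1.1), h',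
            absurd h'.2 (hCD w h.1.1), absurd h.2 h'.2]
        · exact fun h => ⟨Or.inl (Or.inl h), Or.inl (Or.inl h)⟩)
      (by
        ext w
        constructor
        · rintro (((h | h) | h) | ((h | h) | h))
          exacts [⟨hself h, Or.inl (hpC w h)⟩, ⟨hCN h.2, Or.inl h.2⟩, ⟨h.1.2, Or.inr h.1.1⟩,
            ⟨hself h, Or.inl (hpC w h)⟩, ⟨hCN h.2, Or.inl h.2⟩, ⟨h.1.2, Or.inr h.1.1⟩]
        · rintro ⟨hwN, hwC | hwD⟩
          · by_cases h1 : w ∈ X1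
            · exact Or.inl (Or.inl (Or.inr ⟨h1, hwC⟩))
            · have h2 := (hXC w fun h => hCD w h hwC).resolve_left h1
              exact Or.inr (Or.inl (Or.inr ⟨⟨h2, h1⟩, hwC⟩))
          · by_cases h1 : w ∈ W1
            · exact Or.inl (Or.inr ⟨⟨hwD, hwN⟩, h1⟩)
            · exact Or.inr (Or.inr ⟨⟨hwD, hwN⟩, h1⟩))
  have hpY : ∀ z ∈ ({p, q} : Set V), z ∈ Y1 ∧ z ∈ Y2 := fun z hz => by
    rw [← hYi] at hz
    exact hz
  have hC' : ∀ Y : Set V, ({p, q} : Set V) ⊆ Y → G.IsClique C ∨ ∃ Q ⊆ Y, G.IsClique Q ∧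
      (∀ s ∈ Q, ∀ d ∈ D, s ≠ d ∧ ¬ G.Adj s d) ∧ C ⊆ ClosedNbhd G Q := by
    intro Y hY
    refine hC.imp_right ?_
    rintro ⟨Q, hQ, hQD, hQC⟩
    exact ⟨Q, hQ.trans hY, (isClique_pair hpq).subset hQ, fun s hs d hd =>
      ⟨fun h => hpD s (hQ hs) (h ▸ hd), hQD s hs d hd⟩, hQC⟩
  have hWD : ∀ w ∈ W1 ∪ W2, w ∈ D → w ∈ N := by
    intro w hw hwD
    rw [hO.union] at hw
    rcases hw with hw | ⟨z, hz, hwz⟩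
    · exact absurd hwD (hP w hw).1
    · by_cases hzp : z ∈ ({p, q} : Set V)
      · exact Or.inr ⟨z, hzp, hwz⟩
      · exact absurd hwz.symm ((hP z hz).2 hzp w hwD)
  refine hO.not_extends ⟨X1 ∪ Y1 ∩ D, X2 ∪ Y2 ∩ D, ?_, ?_, ?_, ?_, ?_, ?_⟩
  · intro w hw
    by_cases hwD : w ∈ D
    · exact Or.inr ⟨hWY1 (Or.inr ⟨⟨hwD, hWD w (Or.inl hw) hwD⟩, hw⟩), hwD⟩
    · exact Or.inl (hWX1 ⟨hw, hwD⟩)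
  · intro w hw
    by_cases hwD : w ∈ D
    · exact Or.inr ⟨hWY2 (Or.inr ⟨⟨hwD, hWD w (Or.inr hw) hwD⟩,
        fun h => (hP w (hWP w h hw)).1 hwD⟩), hwD⟩
    · exact Or.inl (hWX2 ⟨hw, hwD⟩)
  · refine hX1.glue hY1 hXD1 hDC (fun a ha haC _ => ?_) (hC' _ fun z hz => (hpY z hz).1)
    exact hWY1 (Or.inl (Or.inr ⟨ha, haC⟩))
  · refine hX2.glue hY2 hXD2 hDC (fun a ha haC had => ?_) (hC' _ fun z hz => (hpY z hz).2)
    by_cases ha1 : a ∈ X1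
    · by_cases hap : a ∈ ({p, q} : Set V)
      · exact (hpY a hap).2
      · obtain ⟨d, hd, had⟩ := had
        exact absurd had ((hP a (hXP a ha1 ha)).2 hap d hd)
    · exact hWY2 (Or.inl (Or.inr ⟨⟨ha, ha1⟩, haC⟩))
  · ext w
    constructor
    · rintro ⟨h | h, h' | h'⟩
      · exact hXP w h h'
      · exact absurd h'.2 (hXD1 w h)
      · exact absurd h.2 (hXD2 w h')
      · exact absurd h.2 (hpD w (hYi ▸ ⟨h.1, h'.1⟩))
    · intro h
      rw [← hXi] at h
      exact ⟨Or.inl h.1, Or.inl h.2⟩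
  · refine Set.eq_univ_of_forall fun w => ?_
    by_cases hwD : w ∈ D
    · rcases (hYu ▸ Or.inr hwD : w ∈ Y1 ∪ Y2) with h | h
      exacts [Or.inl (Or.inr ⟨h, hwD⟩), Or.inr (Or.inr ⟨h, hwD⟩)]
    · rcases hXC w hwD with h | h
      exacts [Or.inl (Or.inl h), Or.inr (Or.inl h)]

end Glue

section Neighborhoods

variable {V : Type u} {G : SimpleGraph V}

theorem mem_closedNbhd_singleton {v w : V} : w ∈ ClosedNbhd G {v} ↔ w = v ∨ G.Adj w v := by
  simp [ClosedNbhd]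

theorem EvenHoleFree.adj_or_adj (hEH : EvenHoleFree G) {a b c d : V} (hab : G.Adj a b)
    (hbc : G.Adj b c) (hcd : G.Adj c d) (hda : G.Adj d a) (hac : a ≠ c) (hbd : b ≠ d) :
    G.Adj a c ∨ G.Adj b d := by
  by_contra! hc
  refine hEH _ _ ((isInducedPathFn_two hab hbc hac hc.1).isHoleOn
    (isInducedPathFn_two hda.symm hcd.symm hac hc.1) le_rfl le_rfl (by simp) (by simp) ?_)
    (by decide)
  intro i j hi0 hi hj0 hj
  obtain rfl : i = 1 := by omega
  obtain rfl : j = 1 := by omega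
  simpa using ⟨hbd, hc.2⟩

end Neighborhoods

section SectorWheelFree

variable {V : Type u} [Finite V] {G : SimpleGraph V}

theorem isWheel_of_three {H : Set V} {w a b c : V} (hH : IsHole G H) (hw : w ∉ H)
    (ha : a ∈ H) (hb : b ∈ H) (hc : c ∈ H) (hwa : G.Adj w a) (hwb : G.Adj w b)
    (hwc : G.Adj w c) (hab : a ≠ b) (hac : a ≠ c) (hbc : b ≠ c) : IsWheel G H w := by
  refine ⟨hH, hw, ?_⟩
  rw [← Set.ncard_eq_three.2 ⟨a, b, c, hab, hac, hbc, rfl⟩]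
  refine Set.ncard_le_ncard ?_ (Set.toFinite _)
  rintro z (rfl | rfl | rfl)
  exacts [⟨ha, hwa⟩, ⟨hb, hwb⟩, ⟨hc, hwc⟩]

theorem chordalSet_closedNbhd_singleton (hSW : ∀ (H : Set V) (w : V), ¬ IsSectorWheel G H w)
    (v : V) : ChordalSet G (ClosedNbhd G {v}) := by
  intro H hH hole
  have hadj : ∀ w ∈ H, w ≠ v → G.Adj v w := fun w hw hwv =>
    ((mem_closedNbhd_singleton.1 (hH hw)).resolve_left hwv).symm
  obtain ⟨z, hz⟩ : H.Nonempty := by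
    obtain ⟨n, hn, f, -, hran, -⟩ := hole
    exact ⟨f 0, hran ▸ ⟨0, rfl⟩⟩
  by_cases hv : v ∈ H
  · obtain ⟨n, h, hn, h0, -, hmem, hinj, hadj'⟩ := hole.exists_cyclic_seq hv
    have h2 : G.Adj (h 0) (h 2) := h0 ▸ hadj _ (hmem 2) (by
      rw [← h0, Ne, hinj, Nat.mod_eq_of_lt (by omega), Nat.mod_eq_of_lt (by omega)]; omega)
    rw [hadj', Nat.mod_eq_of_lt (show 0 + 1 < n by omega), Nat.mod_eq_of_lt (show 2 < n by omega),
      Nat.mod_eq_of_lt (show 2 + 1 < n by omega), Nat.mod_eq_of_lt (show 0 < n by omega)] at h2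
    omega
  · have hadj' : ∀ w ∈ H, G.Adj v w := fun w hw => hadj w hw fun h => hv (h ▸ hw)
    obtain ⟨n, h, hn, h0, -, hmem, hinj, -⟩ := hole.exists_cyclic_seq hz
    have hne : ∀ i j, i < j → j < 3 → h i ≠ h j := by
      intro i j hij hj
      rw [Ne, hinj, Nat.mod_eq_of_lt (by omega), Nat.mod_eq_of_lt (by omega)]
      omega
    exact hSW H v ⟨isWheel_of_three hole hv (hmem 0) (hmem 1) (hmem 2) (hadj' _ (hmem 0))
      (hadj' _ (hmem 1)) (hadj' _ (hmem 2)) (hne _ _ (by omega) (by omega))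
      (hne _ _ (by omega) (by omega)) (hne _ _ (by omega) (by omega)), Or.inl hadj'⟩

theorem chordalSet_closedNbhd_pair (hEH : EvenHoleFree G)
    (hSW : ∀ (H : Set V) (w : V), ¬ IsSectorWheel G H w) {v x : V} (h : v = x ∨ G.Adj v x) :
    ChordalSet G (ClosedNbhd G {v, x}) := by
  rcases h with rfl | hvx
  · rw [Set.pair_eq_singleton]
    exact chordalSet_closedNbhd_singleton hSW v
  intro H hH hole
  obtain ⟨d, hdH, hdv⟩ : ∃ d ∈ H, d ∉ ClosedNbhd G {v} := by
    by_contra! hc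
    exact chordalSet_closedNbhd_singleton hSW v H hc hole
  obtain ⟨z, hzH, hzx⟩ : ∃ z ∈ H, z ∉ ClosedNbhd G {x} := by
    by_contra! hc
    exact chordalSet_closedNbhd_singleton hSW x H hc hole
  simp only [mem_closedNbhd_singleton, not_or] at hdv hzx
  have hmem : ∀ w ∈ H, w = v ∨ w = x ∨ G.Adj w v ∨ G.Adj w x := fun w hw =>
    mem_closedNbhd_pair.1 (hH hw)
  let D : Set V := {w | G.Adj w x ∧ w ≠ v ∧ ¬ G.Adj w v}
  have hnear : ∀ w ∈ H, w ∉ D → ∀ d ∈ D, G.Adj w d → w = x ∨ (G.Adj w v ∧ G.Adj w x) := by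
    intro w hw hwD d hd hwd
    by_cases hwx : w = x
    · exact Or.inl hwx
    have hwv : w ≠ v := by rintro rfl; exact hd.2.2 hwd.symm
    have hwv' : G.Adj w v := by
      rcases hmem w hw with h | h | h | h
      · exact absurd h hwv
      · exact absurd h hwx
      · exact h
      · by_contra hc
        exact hwD ⟨h, hwv, hc⟩
    rcases hEH.adj_or_adj hwv' hvx hd.1.symm hwd.symm hwx hd.2.1.symm with h | h
    · exact Or.inr ⟨hwv', h⟩
    · exact absurd h.symm hd.2.2
  have hdD : d ∈ D := by
    rcases hmem d hdH with h | h | h | h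
    · exact absurd h hdv.1
    · exact absurd (h ▸ hvx.symm) hdv.2
    · exact absurd h hdv.2
    · exact ⟨h, hdv⟩
  have hzD : z ∉ D := fun h => hzx.2 h.1
  obtain ⟨a, b, ha, haD, hb, hbD, hab, hnab, hj⟩ := hole.exists_segment hzH hzD
    (fun w _ hwD hzw => by
      rcases hnear z hzH hzD w hwD hzw with h | h
      exacts [hzx.1 h, hzx.2 h.2]) hdH hdD
  obtain ⟨s, t, hs, ht, has, -, htb⟩ := id hj
  have ha' := hnear a ha haD s hs.2 has
  have hb' := hnear b hb hbD t ht.2 htb.symm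
  have hax : a ≠ x := by
    rintro rfl
    rcases hb' with h | h
    exacts [hab h.symm, hnab h.2.symm]
  have hbx : b ≠ x := by
    rintro rfl
    rcases ha' with h | h
    exacts [hab h, hnab h.2]
  have ha2 := ha'.resolve_left hax
  have hb2 := hb'.resolve_left hbx
  obtain ⟨H', hole', hH'⟩ := exists_isHole_of_joinedVia ha2.1.symm hb2.1.symm hab hnab
    (fun w hw => ⟨hw.2.2.1, fun h => hw.2.2.2 h.symm⟩) hj
  refine chordalSet_closedNbhd_singleton hSW x H' (fun w hw => ?_) hole'
  rw [mem_closedNbhd_singleton]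
  rcases hH' w hw with rfl | rfl | rfl | h
  exacts [Or.inr hvx, Or.inr ha2.2, Or.inr hb2.2, Or.inr h.2.1]

end SectorWheelFree

section Obstruction

variable {V : Type u} {G : SimpleGraph V} {x y : V} {W1 W2 : Set V}

theorem IsObstruction.symm (hO : IsObstruction G x y W1 W2) : IsObstruction G y x W1 W2 := by
  obtain ⟨h1, h2, h3, h4, h5, h6⟩ := hO
  rw [Set.pair_comm] at h4 h5 h6
  exact ⟨h1, h2, h3.imp Eq.symm fun h => h.symm, h4, h5, h6⟩

theorem IsObstruction.exists_far (hO : IsObstruction G x y W1 W2) (v : V) :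
    ∃ w, w ∉ ClosedNbhd G {v} := by
  by_contra! hc
  have huniv : ∀ X : Set V, ChordalSet G X := fun X =>
    (hO.chordal v v (Or.inl rfl)).mono fun w _ => by simpa using hc w
  refine hO.not_extends ⟨W1, W2 ∪ W1ᶜ, subset_rfl, Set.subset_union_left, huniv _, huniv _, ?_, ?_⟩
  · rw [Set.inter_union_distrib_left, Set.inter_compl_self, Set.union_empty, hO.inter]
  · rw [Set.union_left_comm, Set.union_compl_self, Set.union_univ]

theorem IsObstruction.reachIn_compl (hO : IsObstruction G x y W1 W2) {p q : V} {Q : Set V}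
    (hpq : p = q ∨ G.Adj p q) (hQ : Q ⊆ {p, q}) (hp : p ∈ ClosedNbhd G Q)
    (hq : q ∈ ClosedNbhd G Q) {d e : V} (hd : d ∉ ClosedNbhd G Q) (he : e ∉ ClosedNbhd G Q)
    (hP : ∀ z ∈ ({x, y} : Set V), ¬ ReachIn G (ClosedNbhd G Q)ᶜ d z ∧
      (z ∉ ({p, q} : Set V) → ∀ w, ReachIn G (ClosedNbhd G Q)ᶜ d w → ¬ G.Adj z w)) :
    ReachIn G (ClosedNbhd G Q)ᶜ d e := by
  by_contra hde
  have hDC : ∀ w, ReachIn G (ClosedNbhd G Q)ᶜ d w → w ∉ ClosedNbhd G Q :=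
    fun w hw => ReachIn.mem (S := (ClosedNbhd G Q)ᶜ) hd hw
  refine hO.no_cutset (C := ClosedNbhd G Q) (D := {w | ReachIn G (ClosedNbhd G Q)ᶜ d w}) hpq
    ⟨d, Relation.ReflTransGen.refl⟩ hDC ?_ ⟨e, ?_⟩ hp hq ?_ hP
    (Or.inr ⟨Q, hQ, ?_, subset_rfl⟩)
  · intro w hw w' hww'
    by_cases hc : w' ∈ ClosedNbhd G Q
    · exact Or.inl hc
    · exact Or.inr (ReachIn.tail hw hww' hc)
  · rintro (h | h)
    exacts [he h, hde h]
  · rintro w (h | ⟨s, hs, hws⟩)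
    exacts [Or.inl (hQ h), Or.inr ⟨s, hQ hs, hws⟩]
  · intro s hs w hw hsw
    exact hDC w hw (Or.inr ⟨s, hs, hsw.symm⟩)

/-- The closed neighborhood of a vertex of the witness path is not a cutset. -/
theorem IsObstruction.reachIn_of_mem (hO : IsObstruction G x y W1 W2) {v : V}
    (hv : v ∈ ({x, y} : Set V)) {d e : V} (hd : d ∉ ClosedNbhd G {v})
    (he : e ∉ ClosedNbhd G {v}) : ReachIn G (ClosedNbhd G {v})ᶜ d e := by
  have hmem : ∀ z ∈ ({x, y} : Set V), z ∈ ClosedNbhd G {v} := by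
    intro z hz
    by_cases hzv : z = v
    · exact Or.inl hzv
    · exact Or.inr ⟨v, rfl, isClique_pair hO.clique hz hv hzv⟩
  refine hO.reachIn_compl hO.clique (by simpa using hv) (hmem x (by simp)) (hmem y (by simp))
    hd he fun z hz => ⟨fun h => ?_, fun h => absurd hz h⟩
  exact ReachIn.mem (S := (ClosedNbhd G {v})ᶜ) hd h (hmem z hz)

theorem IsObstruction.no_clique_cutset (hO : IsObstruction G x y W1 W2) {K D : Set V} {v : V}
    (hK : G.IsClique K) (hv : v ∈ K) (hD : D.Nonempty) (hDK : ∀ d ∈ D, d ∉ K)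
    (hDC : ∀ d ∈ D, ∀ w, G.Adj d w → w ∈ K ∪ D) (hrest : ∃ w, w ∉ K ∪ D) : False := by
  have aux : ∀ D : Set V, D.Nonempty → (∀ d ∈ D, d ∉ K) →
      (∀ d ∈ D, ∀ w, G.Adj d w → w ∈ K ∪ D) → (∃ w, w ∉ K ∪ D) → x ∉ D → y ∉ D → False := by
    intro D hD hDK hDC hrest hx hy
    obtain ⟨p, q, hp, hq, hpq⟩ : ∃ p q, p ∈ K ∧ q ∈ K ∧
        ∀ z ∈ ({x, y} : Set V), z ∈ K → z ∈ ({p, q} : Set V) := by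
      by_cases hx : x ∈ K <;> by_cases hy : y ∈ K
      · exact ⟨x, y, hx, hy, fun z hz _ => hz⟩
      · refine ⟨x, x, hx, hx, ?_⟩
        rintro z (rfl | rfl) hz
        exacts [by simp, absurd hz hy]
      · refine ⟨y, y, hy, hy, ?_⟩
        rintro z (rfl | rfl) hz
        exacts [absurd hz hx, by simp]
      · refine ⟨v, v, hv, hv, ?_⟩
        rintro z (rfl | rfl) hz
        exacts [absurd hz hx, absurd hz hy]
    have hzD : ∀ z ∈ ({x, y} : Set V), z ∉ D := by
      rintro z (rfl | rfl)
      exacts [hx, hy]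
    refine hO.no_cutset (p := p) (q := q) (C := K) (D := D) ?_ hD hDK hDC hrest hp hq ?_ ?_
      (Or.inl hK)
    · by_cases h : p = q
      exacts [Or.inl h, Or.inr (hK hp hq h)]
    · intro w hw
      rw [mem_closedNbhd_pair]
      by_cases h : w = p
      exacts [Or.inl h, Or.inr (Or.inr (Or.inl (hK hw hp h)))]
    · intro z hz
      refine ⟨hzD z hz, fun hzp d hd hzd => ?_⟩
      rcases hDC d hd z hzd.symm with h | h
      exacts [hzp (hpq z hz h), hzD z hz h]
  by_cases hxy : x ∉ D ∧ y ∉ D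
  · exact aux D hD hDK hDC hrest hxy.1 hxy.2
  have hxyD : x ∈ K ∪ D ∧ y ∈ K ∪ D := by
    by_cases hx : x ∈ D
    · refine ⟨Or.inr hx, ?_⟩
      rcases hO.clique with h | h
      exacts [Or.inr (h ▸ hx), hDC x hx y h]
    · have hy : y ∈ D := by tauto
      refine ⟨?_, Or.inr hy⟩
      rcases hO.clique with h | h
      exacts [absurd (h ▸ hy) hx, hDC y hy x h.symm]
  refine aux (K ∪ D)ᶜ hrest (fun d hd h => hd (Or.inl h)) ?_ ?_ (fun h => h hxyD.1)
    (fun h => h hxyD.2)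
  · intro d hd w hdw
    by_cases hw : w ∈ K ∪ D
    · rcases hw with h | h
      exacts [Or.inl h, absurd (hDC w h d hdw.symm) hd]
    · exact Or.inr hw
  · obtain ⟨d, hd⟩ := hD
    refine ⟨d, ?_⟩
    rintro (h | h)
    exacts [hDK d hd h, h (Or.inr hd)]

/-- If `N[v]` is not a cutset, then no vertex is dominated by `v`. -/
theorem IsObstruction.exists_adj_far [Finite V] (hO : IsObstruction G x y W1 W2)
    (hSW : ∀ (H : Set V) (w : V), ¬ IsSectorWheel G H w) {v u : V}
    (hv : ∀ d e, d ∉ ClosedNbhd G {v} → e ∉ ClosedNbhd G {v} →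
      ReachIn G (ClosedNbhd G {v})ᶜ d e) (huv : G.Adj v u) :
    ∃ w, G.Adj u w ∧ w ∉ ClosedNbhd G {v} := by
  by_contra! hu
  let U : Set V := {u | G.Adj v u ∧ ∀ w, G.Adj u w → w ∈ ClosedNbhd G {v}}
  let Q : Set V := {w | ReachIn G U u w}
  have hQU : Q ⊆ U := fun w hw => ReachIn.mem (S := U) ⟨huv, hu⟩ hw
  have huQ : u ∈ Q := Relation.ReflTransGen.refl
  have hvQ : v ∉ Q := fun h => G.loopless.irrefl v (hQU h).1
  let K : Set V := insert v {w | w ∉ Q ∧ ∃ s ∈ Q, G.Adj s w}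
  obtain ⟨t, ht⟩ := hO.exists_far v
  have hKv : ∀ w ∈ K, w ≠ v → G.Adj v w ∧ (∃ s ∈ Q, G.Adj w s) ∧
      ∃ t, t ∉ ClosedNbhd G {v} ∧ G.Adj w t := by
    rintro w (rfl | ⟨hwQ, s, hs, hsw⟩) hwv
    · exact absurd rfl hwv
    have hvw : G.Adj v w :=
      ((mem_closedNbhd_singleton.1 ((hQU hs).2 w hsw)).resolve_left hwv).symm
    refine ⟨hvw, ⟨s, hs, hsw.symm⟩, ?_⟩
    by_contra! hc
    refine hwQ (ReachIn.tail hs hsw ⟨hvw, fun w' hw' => ?_⟩)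
    by_contra hcc
    exact hc w' hcc hw'
  have hKclique : ∀ a ∈ K, ∀ b ∈ K, a ≠ v → b ≠ v → a ≠ b → G.Adj a b := by
    intro a ha b hb hav hbv hab
    by_contra hnab
    obtain ⟨hva, ⟨s, hs, has⟩, s', hs', has'⟩ := hKv a ha hav
    obtain ⟨hvb, ⟨r, hr, hbr⟩, r', hr', hbr'⟩ := hKv b hb hbv
    have hsr : ReachIn G Q s r :=
      ReachIn.restrict_class (a := s) (S := U)
        (Relation.ReflTransGen.trans (ReachIn.symm (S := U) ⟨huv, hu⟩ hs) hr) hs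
    obtain ⟨m, f, hm, f0, fm, hf, hfQ⟩ :=
      (show JoinedVia G Q a b from ⟨s, r, hs, hr, has, hsr, hbr.symm⟩).exists_inducedPathFn
        hab hnab
    obtain ⟨k, g, hk, g0, gk, hg, hgT⟩ :=
      (show JoinedVia G (ClosedNbhd G {v})ᶜ a b from
        ⟨s', r', hs', hr', has', hv _ _ hs' hr', hbr'.symm⟩).exists_inducedPathFn hab hnab
    have hfv : ∀ i ≤ m, G.Adj v (f i) := by
      intro i hi
      by_cases hi0 : i = 0
      · exact hi0 ▸ f0 ▸ hva
      · by_cases him : i = m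
        · exact him ▸ fm ▸ hvb
        · exact (hQU (hfQ i (by omega) (by omega))).1
    have hgv : ∀ j, 0 < j → j < k → g j ≠ v ∧ ¬ G.Adj v (g j) := by
      intro j hj0 hj
      have := hgT j hj0 hj
      rw [Set.mem_compl_iff, mem_closedNbhd_singleton, not_or] at this
      exact ⟨this.1, fun h => this.2 h.symm⟩
    have hole := hf.isHoleOn hg hm hk (f0.trans g0.symm) (fm.trans gk.symm) (by
      intro i j hi0 hi hj0 hj
      refine ⟨fun h => (hgv j hj0 hj).2 (h ▸ hfv i hi.le), fun h => ?_⟩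
      exact hgT j hj0 hj ((hQU (hfQ i hi0 hi)).2 _ h))
    refine hSW _ v ⟨isWheel_of_three ⟨_, hole⟩ ?_ (Or.inl ⟨0, by omega, rfl⟩)
      (Or.inl ⟨1, by omega, rfl⟩) (Or.inl ⟨2, by omega, rfl⟩) (hfv 0 (by omega))
      (hfv 1 (by omega)) (hfv 2 (by omega)) ?_ ?_ ?_, Or.inr
      ⟨(List.range (m + 1)).map f, ⟨by simp, ?_, ?_⟩, ?_⟩⟩
    · rintro (⟨i, hi, h⟩ | ⟨j, hj0, hj, h⟩)
      · exact (hfv i hi).ne h.symm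
      · exact (hgv j hj0 hj).1 h
    · exact fun h => absurd ((hf 0 1 (by omega) (by omega)).1 h) (by omega)
    · exact fun h => absurd ((hf 0 2 (by omega) (by omega)).1 h) (by omega)
    · exact fun h => absurd ((hf 1 2 (by omega) (by omega)).1 h) (by omega)
    · refine List.Nodup.map_on (fun i hi j hj h => ?_) List.nodup_range
      rw [List.mem_range] at hi hj
      exact (hf i j (by omega) (by omega)).1 h
    · intro i j hi hj
      simp only [List.length_map, List.length_range] at hi hj
      simpa using (hf i j (by omega) (by omega)).2
    · ext w
      simp only [List.mem_map, List.mem_range, Set.mem_ofPred_eq, Set.mem_inter_iff]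
      constructor
      · rintro ⟨i, hi, rfl⟩
        exact ⟨Or.inl ⟨i, by omega, rfl⟩, hfv i (by omega)⟩
      · rintro ⟨⟨i, hi, rfl⟩ | ⟨j, hj0, hj, rfl⟩, hvw⟩
        · exact ⟨i, by omega, rfl⟩
        · exact absurd hvw (hgv j hj0 hj).2
  refine hO.no_clique_cutset (K := K) (D := Q) (v := v) ?_ (Or.inl rfl) ⟨u, huQ⟩ ?_ ?_ ⟨t, ?_⟩
  · intro a ha b hb hab
    by_cases hav : a = v
    · subst hav
      exact (hKv b hb hab.symm).1
    · by_cases hbv : b = v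
      · subst hbv
        exact (hKv a ha hav).1.symm
      · exact hKclique a ha b hb hav hbv hab
  · rintro d hd (rfl | h)
    exacts [hvQ hd, h.1 hd]
  · intro d hd w hdw
    by_cases hw : w ∈ Q
    · exact Or.inr hw
    · exact Or.inl (Or.inr ⟨hw, d, hd, hdw⟩)
  · rw [mem_closedNbhd_singleton, not_or] at ht
    rintro (h | h)
    · by_cases htv : t = v
      exacts [ht.1 htv, ht.2 (hKv t h htv).1.symm]
    · exact ht.2 (hQU h).1.symm

end Obstruction

section StarCutset

variable {V : Type u} {G : SimpleGraph V} {x y : V} {W1 W2 : Set V}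

theorem JoinedVia.symm {S : Set V} {a b : V} (h : JoinedVia G S a b) : JoinedVia G S b a := by
  obtain ⟨s, t, hs, ht, h1, h2, h3⟩ := h
  exact ⟨t, s, ht, hs, h3.symm, ReachIn.symm hs h2, h1.symm⟩

/-- A walk from `K` to a vertex outside of `K` has a last vertex in `K`. -/
theorem ReachIn.exists_last {A K : Set V} {a b : V} (h : ReachIn G A a b) (ha : a ∈ A)
    (haK : a ∈ K) (hbK : b ∉ K) :
    ∃ c s, c ∈ K ∧ c ∈ A ∧ G.Adj c s ∧ s ∈ A \ K ∧ ReachIn G (A \ K) s b := by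
  induction h with
  | refl => exact absurd haK hbK
  | @tail b e h' h ih =>
    by_cases hb : b ∈ K
    · exact ⟨b, e, hb, ReachIn.mem ha h', h.1, ⟨h.2, hbK⟩, Relation.ReflTransGen.refl⟩
    · obtain ⟨c, s, hcK, hcA, hcs, hs, hsb⟩ := ih hb
      exact ⟨c, s, hcK, hcA, hcs, hs, ReachIn.tail hsb h.1 ⟨h.2, hbK⟩⟩

theorem IsObstruction.exists_reachIn_not_adj [Finite V] (hO : IsObstruction G x y W1 W2)
    (hEH : EvenHoleFree G) (hSW : ∀ (H : Set V) (w : V), ¬ IsSectorWheel G H w) {v d : V}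
    (hvx : G.Adj v x) (hd : d ∉ ClosedNbhd G {v}) :
    ∃ w, ReachIn G (ClosedNbhd G {v})ᶜ d w ∧ ¬ G.Adj w x := by
  by_contra! hc
  have hdx := hc d Relation.ReflTransGen.refl
  obtain ⟨w, hdw, hw⟩ := hO.exists_adj_far hSW
    (fun _ _ hd he => hO.reachIn_of_mem (by simp) hd he) hdx.symm
  by_cases hwv : w ∈ ClosedNbhd G {v}
  · rw [mem_closedNbhd_singleton, not_or] at hd hw
    rcases mem_closedNbhd_singleton.1 hwv with rfl | hwv
    · exact hd.2 hdw
    rcases hEH.adj_or_adj hwv.symm hdw.symm hdx hvx.symm (Ne.symm hd.1) hw.1 with h | h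
    exacts [hd.2 h.symm, hw.2 h]
  · exact hw (mem_closedNbhd_singleton.2
      (Or.inr (hc w (ReachIn.tail Relation.ReflTransGen.refl hdw hwv))))

theorem IsObstruction.exists_reachIn_adj (hO : IsObstruction G x y W1 W2) {v e e' : V}
    (hvx : G.Adj v x) (hvy : G.Adj v y) (he : e ∉ ClosedNbhd G {v, x})
    (he' : e' ∉ ClosedNbhd G {v, x}) (hee' : ¬ ReachIn G (ClosedNbhd G {v})ᶜ e e') :
    ∃ t, ReachIn G (ClosedNbhd G {v, x})ᶜ e t ∧ G.Adj t y := by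
  by_contra! hc
  have hsub : (ClosedNbhd G {v, x})ᶜ ⊆ (ClosedNbhd G {v})ᶜ := by
    intro w hw
    simp only [Set.mem_compl_iff, mem_closedNbhd_pair, mem_closedNbhd_singleton] at hw ⊢
    tauto
  refine hee' (ReachIn.mono hsub (hO.reachIn_compl (Or.inr hvx) subset_rfl (Or.inl (by simp))
    (Or.inl (by simp)) he he' ?_))
  rintro z (rfl | rfl)
  · exact ⟨fun h => ReachIn.mem (S := (ClosedNbhd G {v, z})ᶜ) he h (Or.inl (by simp)),
      fun h => absurd (by simp) h⟩
  · refine ⟨fun h => ReachIn.mem (S := (ClosedNbhd G {v, x})ᶜ) he h ?_,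
      fun _ w hw h => hc w hw h.symm⟩
    exact mem_closedNbhd_pair.2 (Or.inr (Or.inr (Or.inl hvy.symm)))

theorem IsObstruction.exists_reachIn_far [Finite V] (hO : IsObstruction G x y W1 W2)
    (hEH : EvenHoleFree G) (hSW : ∀ (H : Set V) (w : V), ¬ IsSectorWheel G H w) {v d : V}
    (hvx : G.Adj v x) (hvy : G.Adj v y) (hxy : G.Adj x y) (hd : d ∉ ClosedNbhd G {v}) :
    ∃ w, ReachIn G (ClosedNbhd G {v})ᶜ d w ∧ w ∉ ClosedNbhd G {x, y} := by
  by_contra! hc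
  have hadj : ∀ w, ReachIn G (ClosedNbhd G {v})ᶜ d w → G.Adj w x ∨ G.Adj w y := by
    intro w hw
    have hwv := ReachIn.mem (S := (ClosedNbhd G {v})ᶜ) hd hw
    rw [Set.mem_compl_iff, mem_closedNbhd_singleton, not_or] at hwv
    rcases mem_closedNbhd_pair.1 (hc w hw) with rfl | rfl | h
    exacts [absurd hvx.symm hwv.2, absurd hvy.symm hwv.2, h]
  obtain ⟨b, hb, hbx⟩ := hO.exists_reachIn_not_adj hEH hSW hvx hd
  have hby := (hadj b hb).resolve_left hbx
  have hbv := ReachIn.mem (S := (ClosedNbhd G {v})ᶜ) hd hb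
  rw [Set.mem_compl_iff, mem_closedNbhd_singleton, not_or] at hbv
  obtain ⟨w, hbw, hw⟩ := hO.exists_adj_far hSW
    (fun _ _ hd he => hO.reachIn_of_mem (by simp) hd he) hby.symm
  rw [mem_closedNbhd_singleton, not_or] at hw
  by_cases hwv : w ∈ ClosedNbhd G {v}
  · rcases mem_closedNbhd_singleton.1 hwv with rfl | hwv
    · exact hbv.2 hbw
    rcases hEH.adj_or_adj hwv.symm hbw.symm hby hvy.symm (Ne.symm hbv.1) hw.1 with h | h
    exacts [hbv.2 h.symm, hw.2 h]
  · have hwx := (hadj w (ReachIn.tail hb hbw hwv)).resolve_right hw.2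
    rcases hEH.adj_or_adj hbw hwx hxy hby.symm (fun h => hbv.2 (h ▸ hvx.symm)) hw.1 with h | h
    exacts [hbx h, hw.2 h]

/-- The closed neighborhood of a vertex forming a triangle with the witness path is not a
cutset. -/
theorem IsObstruction.reachIn_of_triangle [Finite V] (hO : IsObstruction G x y W1 W2)
    (hEH : EvenHoleFree G) (hSW : ∀ (H : Set V) (w : V), ¬ IsSectorWheel G H w) {v d e : V}
    (hvx : G.Adj v x) (hvy : G.Adj v y) (hxy : G.Adj x y) (hd : d ∉ ClosedNbhd G {v})
    (he : e ∉ ClosedNbhd G {v}) : ReachIn G (ClosedNbhd G {v})ᶜ d e := by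
  by_contra hde
  obtain ⟨e1, hde1, he1⟩ := hO.exists_reachIn_far hEH hSW hvx hvy hxy hd
  obtain ⟨e2, hee2, he2⟩ := hO.exists_reachIn_far hEH hSW hvx hvy hxy he
  have he1v := ReachIn.mem (S := (ClosedNbhd G {v})ᶜ) hd hde1
  have he2v := ReachIn.mem (S := (ClosedNbhd G {v})ᶜ) he hee2
  have hne : ¬ ReachIn G (ClosedNbhd G {v})ᶜ e2 e1 := by
    intro h
    have h1 := ReachIn.symm (S := (ClosedNbhd G {v})ᶜ) he
      (Relation.ReflTransGen.trans hee2 h)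
    exact hde (Relation.ReflTransGen.trans hde1 h1)
  clear hde hde1 hee2 hd he
  let D : Set V := {w | ReachIn G (ClosedNbhd G {v})ᶜ e2 w}
  let A : Set V := (ClosedNbhd G {x, y})ᶜ
  let K : Set V := {w | w ∈ D ∨ ∃ d ∈ D, G.Adj d w}
  have hDv : ∀ w ∈ D, w ≠ v ∧ ¬ G.Adj w v := by
    intro w hw
    have := ReachIn.mem (S := (ClosedNbhd G {v})ᶜ) he2v hw
    rwa [Set.mem_compl_iff, mem_closedNbhd_singleton, not_or] at this
  have hDne : ∀ d ∈ D, ¬ ReachIn G (ClosedNbhd G {v})ᶜ e1 d := fun d hd h =>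
    hne (Relation.ReflTransGen.trans hd (ReachIn.symm (S := (ClosedNbhd G {v})ᶜ) he1v h))
  have hDne' : ∀ d ∈ D, ¬ ReachIn G (ClosedNbhd G {v})ᶜ d e1 := fun d hd h =>
    hne (Relation.ReflTransGen.trans hd h)
  have hreach : ReachIn G A e2 e1 := by
    refine hO.reachIn_compl (Or.inr hxy) subset_rfl (Or.inl (by simp)) (Or.inl (by simp))
      he2 he1 fun z hz => ⟨fun h => ?_, fun h => absurd hz h⟩
    exact ReachIn.mem (S := A) he2 h (Or.inl hz)
  obtain ⟨c, s, hcK, hcA, hcs, hs, hse1⟩ := hreach.exists_last (K := K) he2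
    (Or.inl Relation.ReflTransGen.refl) (by
      rintro (h | ⟨d, hd, h⟩)
      exacts [hne h, hne (ReachIn.tail hd h he1v)])
  have hcD : c ∉ D := fun h => hs.2 (Or.inr ⟨c, h, hcs⟩)
  obtain ⟨d, hd, hdc⟩ := hcK.resolve_left hcD
  obtain ⟨hdv, hdv'⟩ := hDv d hd
  have hcv : G.Adj c v := by
    by_contra hc
    refine hcD (ReachIn.tail hd hdc ?_)
    rw [Set.mem_compl_iff, mem_closedNbhd_singleton, not_or]
    exact ⟨fun h => hdv' (h ▸ hdc), hc⟩
  have hAadj : ∀ w ∈ A, w ≠ x ∧ w ≠ y ∧ ¬ G.Adj w x ∧ ¬ G.Adj w y := by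
    intro w hw
    simpa [A, mem_closedNbhd_pair] using hw
  obtain ⟨hcx, hcy, hcx', hcy'⟩ := hAadj c hcA
  have hdz : ∀ z, G.Adj v z → c ≠ z → ¬ G.Adj c z → d ∉ ClosedNbhd G {v, z} := by
    intro z hvz hcz hcz' h
    rcases mem_closedNbhd_pair.1 h with h | h | h | h
    · exact hdv h
    · exact hdv' (h ▸ hvz.symm)
    · exact hdv' h
    · rcases hEH.adj_or_adj hcv.symm hdc.symm h hvz.symm (Ne.symm hdv) hcz with h | h
      exacts [hdv' h.symm, hcz' h]
  have hdx := hdz x hvx hcx hcx'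
  have hdy := hdz y hvy hcy hcy'
  have he1vy : e1 ∉ ClosedNbhd G {v, y} := by
    have := hAadj e1 he1
    rw [Set.mem_compl_iff, mem_closedNbhd_singleton, not_or] at he1v
    rw [mem_closedNbhd_pair]
    tauto
  have he1vx : e1 ∉ ClosedNbhd G {v, x} := by
    have := hAadj e1 he1
    rw [Set.mem_compl_iff, mem_closedNbhd_singleton, not_or] at he1v
    rw [mem_closedNbhd_pair]
    tauto
  have hsub : ∀ z, (ClosedNbhd G {v, z})ᶜ ⊆ (ClosedNbhd G {v})ᶜ := by
    intro z w hw
    simp only [Set.mem_compl_iff, mem_closedNbhd_pair, mem_closedNbhd_singleton] at hw ⊢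
    tauto
  let B : Set V := {w | ReachIn G (ClosedNbhd G {v, y})ᶜ e1 w}
  have hB : ∀ w ∈ B, (w ≠ y ∧ ¬ G.Adj w y) ∧ ∀ d ∈ D, w ≠ d ∧ ¬ G.Adj w d := by
    intro w hw
    have hw' := ReachIn.mem (S := (ClosedNbhd G {v, y})ᶜ) he1vy hw
    rw [Set.mem_compl_iff, mem_closedNbhd_pair] at hw'
    refine ⟨by tauto, fun d hd => ⟨?_, fun h => ?_⟩⟩
    · rintro rfl
      exact hDne w hd (ReachIn.mono (hsub y) hw)
    · exact hDne d hd (ReachIn.tail (ReachIn.mono (hsub y) hw) h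
        (ReachIn.mem (S := (ClosedNbhd G {v})ᶜ) he2v hd))
  have hS : ∀ w ∈ A \ K ∪ B, (w ≠ y ∧ ¬ G.Adj w y) ∧ ∀ d ∈ D, w ≠ d ∧ ¬ G.Adj w d := by
    rintro w (⟨hwA, hwK⟩ | hw)
    · have := hAadj w hwA
      refine ⟨by tauto, fun d hd => ⟨?_, fun h => hwK (Or.inr ⟨d, hd, h.symm⟩)⟩⟩
      rintro rfl
      exact hwK (Or.inl hd)
    · exact hB w hw
  obtain ⟨t1, ht1, ht1x⟩ := hO.symm.exists_reachIn_adj hvy hvx he1vy hdy (hDne d hd)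
  obtain ⟨M, f, hM, f0, fM, hf, hfS⟩ := (show JoinedVia G (A \ K ∪ B) x c from
    JoinedVia.symm ⟨s, t1, Or.inl hs, Or.inr ht1, hcs, Relation.ReflTransGen.trans
      (ReachIn.mono Set.subset_union_left hse1) (ReachIn.mono Set.subset_union_right
        (ReachIn.restrict_class ht1 Relation.ReflTransGen.refl)),
      ht1x⟩).exists_inducedPathFn (Ne.symm hcx) (fun h => hcx' h.symm)
  obtain ⟨t2, ht2, ht2y⟩ := hO.exists_reachIn_adj hvx hvy hdx he1vx (hDne' d hd)
  obtain ⟨L, g, hL, g0, gL, hg, hgT⟩ :=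
    (show JoinedVia G {w | ReachIn G (ClosedNbhd G {v, x})ᶜ d w} y c from
      JoinedVia.symm ⟨d, t2, Relation.ReflTransGen.refl, ht2, hdc.symm,
        ReachIn.restrict_class ht2 Relation.ReflTransGen.refl, ht2y⟩).exists_inducedPathFn
      (Ne.symm hcy) (fun h => hcy' h.symm)
  obtain ⟨t3, ht3, ht3x⟩ := hO.symm.exists_reachIn_adj hvy hvx hdy he1vy (hDne' d hd)
  have hDtrans : ∀ w, ReachIn G (ClosedNbhd G {v})ᶜ d w → w ∈ D := fun w hw =>
    Relation.ReflTransGen.trans hd hw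
  obtain ⟨J, k, hJ, k0, kJ, hk, hkD⟩ := (show JoinedVia G D x c from
    JoinedVia.symm ⟨d, t3, hd, hDtrans _ (ht3.mono (hsub y)), hdc.symm,
      ReachIn.restrict_class (ht3.mono (hsub y)) hd, ht3x⟩).exists_inducedPathFn
      (Ne.symm hcx) (fun h => hcx' h.symm)
  have hgD : ∀ i, 0 < i → i < L → g i ∈ D := fun i h0 hi =>
    hDtrans _ ((hgT i h0 hi).mono (hsub x))
  have hgx : ∀ i, 0 < i → i ≤ L → x ≠ g i ∧ ¬ G.Adj x (g i) := by
    intro i h0 hi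
    by_cases hiL : i = L
    · rw [hiL, gL]
      exact ⟨Ne.symm hcx, fun h => hcx' h.symm⟩
    · have := ReachIn.mem (S := (ClosedNbhd G {v, x})ᶜ) hdx (hgT i h0 (by omega))
      rw [Set.mem_compl_iff, mem_closedNbhd_pair] at this
      exact ⟨fun h => this (Or.inr (Or.inl h.symm)), fun h => this (by simp [h.symm])⟩
  have hcons := hg.cons (x := x) (g0 ▸ hxy) hgx
  have hole1 := hf.isHoleOn hcons hM (by omega) (by simpa using f0) (by simpa [gL] using fM) (by
    intro i j hi0 hi hj0 hj
    have hfi := hS _ (hfS i hi0 hi)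
    by_cases hj1 : j = 1
    · simpa [hj1, g0] using hfi.1
    · simpa [hj0.ne'] using hfi.2 _ (hgD (j - 1) (by omega) (by omega)))
  have hole2 := hf.isHoleOn hk hM hJ (f0.trans k0.symm) (fM.trans kJ.symm)
    fun i j hi0 hi hj0 hj => (hS _ (hfS i hi0 hi)).2 _ (hkD j hj0 hj)
  have hole3 := hg.isHoleOn (isInducedPathFn_two hvy.symm hcv.symm (Ne.symm hcy)
    (fun h => hcy' h.symm)) hL le_rfl (by simpa using g0) (by simpa using gL) (by
    intro i j hi0 hi hj0 hj
    obtain rfl : j = 1 := by omega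
    simpa using hDv _ (hgD i hi0 hi))
  have hole4 := hk.isHoleOn (isInducedPathFn_two hvx.symm hcv.symm (Ne.symm hcx)
    (fun h => hcx' h.symm)) hJ le_rfl (by simpa using k0) (by simpa using kJ) (by
    intro i j hi0 hi hj0 hj
    obtain rfl : j = 1 := by omega
    simpa using hDv _ (hkD i hi0 hi))
  have h1 := hEH _ _ hole1
  have h2 := hEH _ _ hole2
  have h3 := hEH _ _ hole3
  have h4 := hEH _ _ hole4
  rw [Nat.not_even_iff] at h1 h2 h3 h4
  omega

/-- No closed neighborhood of a vertex is a cutset of an obstruction. -/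
theorem IsObstruction.reachIn_compl_closedNbhd [Finite V] (hO : IsObstruction G x y W1 W2)
    (hEH : EvenHoleFree G) (hSW : ∀ (H : Set V) (w : V), ¬ IsSectorWheel G H w) (v : V)
    {d e : V} (hd : d ∉ ClosedNbhd G {v}) (he : e ∉ ClosedNbhd G {v}) :
    ReachIn G (ClosedNbhd G {v})ᶜ d e := by
  by_cases hv : v ∈ ({x, y} : Set V)
  · exact hO.reachIn_of_mem hv hd he
  by_contra hde
  have hed : ¬ ReachIn G (ClosedNbhd G {v})ᶜ e d := fun h => hde (ReachIn.symm he h)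
  by_cases htri : G.Adj v x ∧ G.Adj v y ∧ G.Adj x y
  · exact hde (hO.reachIn_of_triangle hEH hSW htri.1 htri.2.1 htri.2.2 hd he)
  have hfar : ∀ z ∈ ({x, y} : Set V), ¬ G.Adj v z → z ∉ ClosedNbhd G {v} := by
    intro z hz hvz h
    rcases mem_closedNbhd_singleton.1 h with rfl | h
    exacts [hv hz, hvz h.symm]
  -- At most one vertex of the witness path is adjacent to `v`; the others reach each other.
  obtain ⟨p, o, hvp, hp⟩ : ∃ p o, (v = p ∨ G.Adj v p) ∧ ∀ z ∈ ({x, y} : Set V),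
      z = p ∨ (z ∉ ClosedNbhd G {v} ∧ ReachIn G (ClosedNbhd G {v})ᶜ z o) := by
    by_cases hvx : G.Adj v x
    · refine ⟨x, y, Or.inr hvx, ?_⟩
      rintro z (rfl | rfl)
      · exact Or.inl rfl
      · rcases hO.clique with h | h
        · exact Or.inl h.symm
        · exact Or.inr ⟨hfar z (by simp) fun h' => htri ⟨hvx, h', h⟩, Relation.ReflTransGen.refl⟩
    · have hx := hfar x (by simp) hvx
      by_cases hvy : G.Adj v y
      · refine ⟨y, x, Or.inr hvy, ?_⟩
        rintro z (rfl | rfl)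
        exacts [Or.inr ⟨hx, Relation.ReflTransGen.refl⟩, Or.inl rfl]
      · refine ⟨v, x, Or.inl rfl, ?_⟩
        rintro z (rfl | rfl)
        · exact Or.inr ⟨hx, Relation.ReflTransGen.refl⟩
        · refine Or.inr ⟨hfar z (by simp) hvy, ?_⟩
          rcases hO.clique with h | h
          · exact h ▸ Relation.ReflTransGen.refl
          · exact ReachIn.tail Relation.ReflTransGen.refl h.symm hx
  have key : ∀ a b, a ∉ ClosedNbhd G {v} → b ∉ ClosedNbhd G {v} →
      ¬ ReachIn G (ClosedNbhd G {v})ᶜ a o → ReachIn G (ClosedNbhd G {v})ᶜ a b := by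
    intro a b ha hb hao
    have hpN : p ∈ ClosedNbhd G {v} :=
      mem_closedNbhd_singleton.2 (hvp.imp Eq.symm fun h => h.symm)
    refine hO.reachIn_compl (Q := {v}) hvp (by simp) (Or.inl rfl) hpN ha hb fun z hz => ?_
    rcases hp z hz with rfl | ⟨hzv, hzo⟩
    · exact ⟨fun h => ReachIn.mem (S := (ClosedNbhd G {v})ᶜ) ha h hpN,
        fun h => absurd (by simp) h⟩
    · exact ⟨fun h => hao (Relation.ReflTransGen.trans h hzo), fun _ w hw h =>
        hao (Relation.ReflTransGen.trans (ReachIn.tail hw h.symm hzv) hzo)⟩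
  by_cases hdo : ReachIn G (ClosedNbhd G {v})ᶜ d o
  · by_cases heo : ReachIn G (ClosedNbhd G {v})ᶜ e o
    · exact hde (Relation.ReflTransGen.trans hdo (ReachIn.symm he heo))
    · exact hed (key e d he hd heo)
  · exact hde (key d e hd he hdo)

end StarCutset

/-- A minimal non-weakly FPE graph with no even hole and no sector wheel has no star
cutset. -/
theorem stmt19 {V : Type u} [Finite V] (G : SimpleGraph V)
    (hG : MinNonWeaklyFPE G)
    (hEH : EvenHoleFree G)
    (hSW : ∀ (H : Set V) (w : V), ¬ IsSectorWheel G H w) :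
    ¬ HasStarCutset G := by
  obtain ⟨hnot, hsub⟩ := hG
  simp only [WeaklyFPE, not_forall] at hnot
  obtain ⟨l, hl, hl2, W1, W2, -, -, hinter, hunion, hext⟩ := hnot
  obtain ⟨x, y, hxy, hlxy⟩ := exists_pair_of_isInducedPathList hl hl2
  rw [hlxy] at hinter hunion hext
  have hO : IsObstruction G x y W1 W2 :=
    ⟨hsub, fun _ _ h => chordalSet_closedNbhd_pair hEH hSW h, hxy, hinter, hunion, hext⟩
  rintro ⟨-, v, C, hvC, hC, hnc⟩
  have hfull : ∀ d e, d ∉ ClosedNbhd G {v} → e ∉ ClosedNbhd G {v} →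
      ReachIn G (ClosedNbhd G {v})ᶜ d e := fun _ _ hd he =>
    hO.reachIn_compl_closedNbhd hEH hSW v hd he
  have hsubC : (ClosedNbhd G {v})ᶜ ⊆ Cᶜ := by
    intro w hw hwC
    refine hw (mem_closedNbhd_singleton.2 ?_)
    exact (hC hwC).imp id fun h => SimpleGraph.Adj.symm h
  have hexit : ∀ a ∉ C, ∃ w, w ∉ ClosedNbhd G {v} ∧ ReachIn G Cᶜ a w := by
    intro a ha
    by_cases hav : a ∈ ClosedNbhd G {v}
    · rcases mem_closedNbhd_singleton.1 hav with rfl | hav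
      · exact absurd hvC ha
      · obtain ⟨w, haw, hw⟩ := hO.exists_adj_far hSW hfull hav.symm
        exact ⟨w, hw, ReachIn.tail Relation.ReflTransGen.refl haw (hsubC hw)⟩
    · exact ⟨a, hav, Relation.ReflTransGen.refl⟩
  obtain ⟨w, hw⟩ := hO.exists_far v
  refine hnc (connected_of_reachIn ⟨w, hsubC hw⟩ fun a ha b hb => ?_)
  obtain ⟨a', ha', haa'⟩ := hexit a ha
  obtain ⟨b', hb', hbb'⟩ := hexit b hb
  exact Relation.ReflTransGen.trans haa' (Relation.ReflTransGen.trans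
    (ReachIn.mono hsubC (hfull _ _ ha' hb')) (ReachIn.symm (S := Cᶜ) hb hbb'))
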